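/- arXiv:0802.1226 — 9 statements merged into one kernel-verified Lean document; each statement's English description precedes it below -/
import Mathlib

section
/- For every n ≥ 1, let FA_n be the full NFW over a state set S of n states in which all states are initial and all states are final (I = F = S). Then every NFW accepting the complement (𝒫(S × S))* \ L(FA_n) has at least 2^n states. -/
namespace YanPaper

/-- A finite run, represented as the list of visited states, over a finite word. -/
def RunOn {S A : Type*} (Δ : S → A → S → Prop) : List S → List A → Prop
  | [_], [] => True
  | p :: q :: ρ, a :: w => Δ p a q ∧ RunOn Δ (q :: ρ) w
  | _, _ => False

/-- `p` reaches `q` via some finite run over the word `w`. -/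
def Reaches {S A : Type*} (Δ : S → A → S → Prop) (p : S) (w : List A) (q : S) : Prop :=
  ∃ ρ : List S, RunOn Δ ρ w ∧ ρ.head? = some p ∧ ρ.getLast? = some q

/-- `p` reaches `q` via some finite run over `w` that visits the set `T`. -/
def ReachesVisit {S A : Type*} (Δ : S → A → S → Prop) (T : Set S) (p : S) (w : List A)
    (q : S) : Prop :=
  ∃ ρ : List S, RunOn Δ ρ w ∧ ρ.head? = some p ∧ ρ.getLast? = some q ∧ ∃ s ∈ ρ, s ∈ T

/-- Nondeterministic finite word automaton. -/
structure NFW (A : Type*) (S : Type*) where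
  I : Set S
  Δ : S → A → S → Prop
  F : Set S

def NFW.Lang {A S : Type*} (M : NFW A S) : Set (List A) :=
  {w | ∃ p ∈ M.I, ∃ q ∈ M.F, Reaches M.Δ p w q}

/-- The full NFW over state set `S`: the alphabet is the set of all binary relations on `S`. -/
def FullNFW (S : Type*) (I F : Set S) : NFW (Set (S × S)) S where
  I := I
  Δ := fun p a q => (p, q) ∈ a
  F := F

/-- Minimal number of states of an NFW over alphabet `A` accepting the language `L`. -/
noncomputable def NFWminStates (A : Type*) (L : Set (List A)) : ℕ :=
  sInf {c : ℕ | ∃ C : NFW A (Fin c), C.Lang = L}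

/-- A two letter alphabet. -/
inductive AB : Type
  | a : AB
  | b : AB

/-- States occurring infinitely often in an infinite run. -/
def InfOcc {S : Type*} (ρ : ℕ → S) : Set S := {s | ∀ n : ℕ, ∃ m, n ≤ m ∧ ρ m = s}

/-- Nondeterministic Büchi word automaton. -/
structure NBW (A : Type*) (S : Type*) where
  I : Set S
  Δ : S → A → S → Prop
  F : Set S

def NBW.Lang {A S : Type*} (M : NBW A S) : Set (ℕ → A) :=
  {α | ∃ ρ : ℕ → S, ρ 0 ∈ M.I ∧ (∀ i, M.Δ (ρ i) (α i) (ρ (i + 1))) ∧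
        (InfOcc ρ ∩ M.F).Nonempty}

/-- The full NBW over state set `S`. -/
def FullNBW (S : Type*) (I F : Set S) : NBW (Set (S × S)) S where
  I := I
  Δ := fun p a q => (p, q) ∈ a
  F := F

/-- Minimal number of states of an NBW over alphabet `A` accepting the ω-language `L`. -/
noncomputable def NBWminStates (A : Type*) (L : Set (ℕ → A)) : ℕ :=
  sInf {c : ℕ | ∃ C : NBW A (Fin c), C.Lang = L}

/-- Vertex `(q, l)` of the Δ-graph of `α` is reachable from an initial vertex `(q_I, 0)`. -/
def GraphReach {A S : Type*} (M : NBW A S) (α : ℕ → A) (q : S) (l : ℕ) : Prop :=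
  ∃ ρ : ℕ → S, ρ 0 ∈ M.I ∧ (∀ i, i < l → M.Δ (ρ i) (α i) (ρ (i + 1))) ∧ ρ l = q

/-- A co-Büchi ranking for the Δ-graph of `α` under `M`, as a partial function
`S × ℕ → {0, …, 2n-2}` represented with `Option ℕ`. -/
def CRanking {A S : Type*} [Fintype S] (M : NBW A S) (α : ℕ → A)
    (f : S → ℕ → Option ℕ) : Prop :=
  (∀ q l r, f q l = some r → r ≤ 2 * Fintype.card S - 2) ∧
  (∀ q l, (f q l).isSome ↔ GraphReach M α q l) ∧
  (∀ q l r, f q l = some r → Odd r → q ∉ M.F) ∧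
  (∀ q l q', M.Δ q (α l) q' → ∀ r r', f q l = some r → f q' (l + 1) = some r' → r' ≤ r)

/-- The C-ranking `f` is odd: every infinite path of the Δ-graph starting at an initial
vertex has infinitely many odd-ranked vertices. -/
def OddCRanking {A S : Type*} [Fintype S] (M : NBW A S) (α : ℕ → A)
    (f : S → ℕ → Option ℕ) : Prop :=
  ∀ ρ : ℕ → S, ρ 0 ∈ M.I → (∀ i, M.Δ (ρ i) (α i) (ρ (i + 1))) →
    ∀ N : ℕ, ∃ l, N ≤ l ∧ ∃ r, f (ρ l) l = some r ∧ Odd r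

/-- The state space of the full NBW `FB n`: `none` is the final state `s_f`, and
`some i` is the main state `s_i`. -/
abbrev FBState (n : ℕ) := Option (Fin (n - 1))

/-- The alphabet of a full automaton with state space `FBState n`. -/
abbrev FBAlpha (n : ℕ) := Set (FBState n × FBState n)

/-- The full NBW `FB n`, with `n` states, main states initial and `s_f = none` final. -/
def FB (n : ℕ) : NBW (FBAlpha n) (FBState n) where
  I := {s | s ≠ none}
  Δ := fun p a q => (p, q) ∈ a
  F := {none}

/-- A `Q(m)`-ranking for `FB n`: a function on the main states with values in
`{0, …, 2m-1}` whose range contains all odd numbers in `{0, …, 2m-1}`. -/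
def QRanking (n m : ℕ) (g : Fin (n - 1) → ℕ) : Prop :=
  (∀ q, g q < 2 * m) ∧ ∀ r, r < 2 * m → Odd r → ∃ q, g q = r

/-- `w` is an `(f, g)`-segment for `FB n` (properties (P1), (P2), (P3)). -/
def IsSeg (n : ℕ) (f g : Fin (n - 1) → ℕ) (w : List (FBAlpha n)) : Prop :=
  w ≠ [] ∧
  (∀ p q : Fin (n - 1),
    Reaches (FB n).Δ (some p) w (some q) ↔ (g q < f p ∨ (f p = g q ∧ Odd (f p)))) ∧
  (∀ p q : Fin (n - 1),
    ReachesVisit (FB n).Δ {none} (some p) w (some q) ↔ g q < f p) ∧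
  (∀ p q : FBState n, Reaches (FB n).Δ p w q → p ≠ none ∧ q ≠ none)

/-- `L(n, m)`: the number of `Q(m)`-rankings for `FB n`. -/
noncomputable def Lnm (n m : ℕ) : ℕ := Nat.card {g : Fin (n - 1) → ℕ // QRanking n m g}

/-- `L(n) = max_{1 ≤ m < n} L(n, m)`. -/
noncomputable def Lmax (n : ℕ) : ℕ := (Finset.Ico 1 n).sup (fun m => Lnm n m)

/-- Nondeterministic Muller word automaton. -/
structure NMW (A : Type*) (S : Type*) where
  I : Set S
  Δ : S → A → S → Prop
  Acc : Set (Set S)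

def NMW.Lang {A S : Type*} (M : NMW A S) : Set (ℕ → A) :=
  {α | ∃ ρ : ℕ → S, ρ 0 ∈ M.I ∧ (∀ i, M.Δ (ρ i) (α i) (ρ (i + 1))) ∧ InfOcc ρ ∈ M.Acc}

/-- Nondeterministic generalized Büchi word automaton of index `k`. -/
structure NGBW (A : Type*) (S : Type*) where
  I : Set S
  Δ : S → A → S → Prop
  k : ℕ
  F : Fin k → Set S

def NGBW.Lang {A S : Type*} (M : NGBW A S) : Set (ℕ → A) :=
  {α | ∃ ρ : ℕ → S, ρ 0 ∈ M.I ∧ (∀ i, M.Δ (ρ i) (α i) (ρ (i + 1))) ∧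
        ∀ i, (InfOcc ρ ∩ M.F i).Nonempty}

/-- Nondeterministic Streett word automaton of index `k`. -/
structure NSW (A : Type*) (S : Type*) where
  I : Set S
  Δ : S → A → S → Prop
  k : ℕ
  acc : Fin k → Set S × Set S

def NSW.Lang {A S : Type*} (M : NSW A S) : Set (ℕ → A) :=
  {α | ∃ ρ : ℕ → S, ρ 0 ∈ M.I ∧ (∀ i, M.Δ (ρ i) (α i) (ρ (i + 1))) ∧
        ∀ i, (InfOcc ρ ∩ (M.acc i).2).Nonempty → (InfOcc ρ ∩ (M.acc i).1).Nonempty}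

/-- Nondeterministic Rabin word automaton of index `k`. -/
structure NRW (A : Type*) (S : Type*) where
  I : Set S
  Δ : S → A → S → Prop
  k : ℕ
  acc : Fin k → Set S × Set S

def NRW.Lang {A S : Type*} (M : NRW A S) : Set (ℕ → A) :=
  {α | ∃ ρ : ℕ → S, ρ 0 ∈ M.I ∧ (∀ i, M.Δ (ρ i) (α i) (ρ (i + 1))) ∧
        ∃ i, (InfOcc ρ ∩ (M.acc i).1).Nonempty ∧ InfOcc ρ ∩ (M.acc i).2 = ∅}

/-- The `k`-fold concatenation `w^k` of a finite word. -/
def listPow {A : Type*} (w : List A) (k : ℕ) : List A := (List.replicate k w).flatten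

/-- `α` is the ω-word `u · v^ω`. -/
def IsUVOmega {A : Type*} (u v : List A) (α : ℕ → A) : Prop :=
  (∀ i (h : i < u.length), α i = u.get ⟨i, h⟩) ∧
  (∀ i j (h : j < v.length), α (u.length + i * v.length + j) = v.get ⟨j, h⟩)

/-- A GC-segment of the NGBW `B`: a nonempty finite word `w` with `w^ω ∉ L(B)`. -/
def GCSeg {A S : Type*} (B : NGBW A S) (w : List A) : Prop :=
  w ≠ [] ∧ ∀ α, IsUVOmega [] w α → α ∉ B.Lang

/-- Two GC-segments conflict: every ω-word `w₁^{k₀} (w₁^{k₁} w₂^{k₂})^ω` is in `L(B)`. -/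
def Conflict {A S : Type*} (B : NGBW A S) (w₁ w₂ : List A) : Prop :=
  ∀ k₀ k₁ k₂ : ℕ, 0 < k₀ → 0 < k₁ → 0 < k₂ →
    ∀ α, IsUVOmega (listPow w₁ k₀) (listPow w₁ k₁ ++ listPow w₂ k₂) α → α ∈ B.Lang

/-- The full NGBW `FB (n,k)` with all states initial, distinguished state `s_nf = none`,
and acceptance sets `F i` (subsets of the main states). -/
def FBgen (n k : ℕ) (F : Fin k → Finset (Fin (n - 1))) :
    NGBW (FBAlpha n) (FBState n) where
  I := Set.univ
  Δ := fun p a q => (p, q) ∈ a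
  k := k
  F := fun i => {s | ∃ q ∈ F i, s = some q}

/-- The conditions on the acceptance condition of `FB (n,k)`: the sets are pairwise
distinct, each of size `⌊(n-1)/2⌋`, and each main state avoids at least `⌊k/2⌋` sets. -/
def GoodAcc (n k : ℕ) (F : Fin k → Finset (Fin (n - 1))) : Prop :=
  Function.Injective F ∧ (∀ i, (F i).card = (n - 1) / 2) ∧
  ∀ q : Fin (n - 1), k / 2 ≤ {i : Fin k | q ∉ F i}.ncard

/-- A PGCL-ranking for `FB (n,k)`: `f` is a bijection from the main states onto
`{1, …, n-1}` and `g` chooses for each main state `q` an index with `q ∉ F (g q)`. -/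
def PGCL (n k : ℕ) (F : Fin k → Finset (Fin (n - 1)))
    (f : Fin (n - 1) → ℕ) (g : Fin (n - 1) → Fin k) : Prop :=
  (∀ p, 1 ≤ f p ∧ f p ≤ n - 1) ∧ Function.Injective f ∧
  (∀ r, 1 ≤ r → r ≤ n - 1 → ∃ p, f p = r) ∧
  ∀ q, q ∉ F (g q)

/-- `ρ` is a finite run over `w` from `p` to `q`. -/
def RunFromTo {S A : Type*} (Δ : S → A → S → Prop) (w : List A) (p q : S)
    (ρ : List S) : Prop :=
  RunOn Δ ρ w ∧ ρ.head? = some p ∧ ρ.getLast? = some q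

/-- `w` is an `⟨f, g⟩`-segment for `FB (n,k)` (properties (Q0)–(Q3)). -/
def IsSegGen (n k : ℕ) (F : Fin k → Finset (Fin (n - 1)))
    (f : Fin (n - 1) → ℕ) (g : Fin (n - 1) → Fin k)
    (w : List (FBAlpha n)) : Prop :=
  w ≠ [] ∧
  -- (Q0) every finite run over `w` ends in a main state
  (∀ (ρ : List (FBState n)) (x : FBState n),
    RunOn (FBgen n k F).Δ ρ w → ρ.getLast? = some x → x ≠ none) ∧
  -- (Q1)
  (∀ p : Fin (n - 1),
    (∃! ρ, RunFromTo (FBgen n k F).Δ w (some p) (some p) ρ) ∧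
    ∀ ρ, RunFromTo (FBgen n k F).Δ w (some p) (some p) ρ →
      (∀ i, i ≠ g p → ∃ s ∈ ρ, ∃ q ∈ F i, s = some q) ∧
      (∀ s ∈ ρ, ∀ q ∈ F (g p), s ≠ some q)) ∧
  -- (Q2)
  (∀ p q : Fin (n - 1), f q < f p →
    (∃! ρ, RunFromTo (FBgen n k F).Δ w (some p) (some q) ρ) ∧
    ∀ ρ, RunFromTo (FBgen n k F).Δ w (some p) (some q) ρ →
      ∀ i, ∃ s ∈ ρ, ∃ r ∈ F i, s = some r) ∧
  -- (Q3)
  (∀ p q : Fin (n - 1), f p < f q →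
    ¬∃ ρ, RunFromTo (FBgen n k F).Δ w (some p) (some q) ρ)

theorem reaches_two {S A : Type*} (D : S → A → S → Prop) (p q : S) (a b : A) :
    Reaches D p [a, b] q ↔ ∃ r, D p a r ∧ D r b q := by
  constructor
  · rintro ⟨ρ, h, h1, h2⟩
    match ρ, h, h1, h2 with
    | [x, y, z], h, h1, h2 =>
      simp [RunOn] at h h1 h2
      subst h1 h2
      exact ⟨y, h⟩
    | [], h, _, _ => simp [RunOn] at h
    | [x], h, _, _ => simp [RunOn] at h
    | [x, y], h, _, _ => simp [RunOn] at h
    | x :: y :: z :: t :: l, h, _, _ => simp [RunOn] at h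
  · rintro ⟨r, h1, h2⟩
    exact ⟨[p, r, q], by simp [RunOn, h1, h2], rfl, rfl⟩

/-- For every `n ≥ 1`, every NFW accepting the complement of the language of
the full NFW over `n` states with all states initial and final has at least `2^n` states. -/
theorem full_nfw_complementation_lower_bound (n : ℕ) (hn : 1 ≤ n)
    (T : Type) [Fintype T] (C : NFW (Set (Fin n × Fin n)) T)
    (hC : C.Lang = (FullNFW (Fin n) Set.univ Set.univ).Langᶜ) :
    2 ^ n ≤ Fintype.card T := by
  classical
  let a : Set (Fin n) → Set (Fin n × Fin n) := fun X => {x | x.1 = x.2 ∧ x.1 ∈ X}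
  let b : Set (Fin n) → Set (Fin n × Fin n) := fun X => {x | x.1 = x.2 ∧ x.1 ∉ X}
  have key : ∀ X Y, [a X, b Y] ∈ C.Lang ↔ X ⊆ Y := by
    intro X Y
    rw [hC]
    simp only [NFW.Lang, FullNFW, reaches_two, Set.mem_compl_iff, Set.mem_ofPred_eq, a, b]
    constructor
    · intro h x hx
      by_contra hy
      exact h ⟨x, trivial, x, trivial, x, ⟨rfl, hx⟩, rfl, hy⟩
    · rintro h ⟨p, -, q, -, r, ⟨h1, h2⟩, h3, h4⟩
      subst h1
      exact h4 (h h2)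
  have h : ∀ X, ∃ r, (∃ p ∈ C.I, C.Δ p (a X) r) ∧ ∃ q ∈ C.F, C.Δ r (b X) q := by
    intro X
    obtain ⟨p, hp, q, hq, hr⟩ := (key X X).2 subset_rfl
    obtain ⟨r, h1, h2⟩ := (reaches_two _ _ _ _ _).1 hr
    exact ⟨r, ⟨p, hp, h1⟩, q, hq, h2⟩
  choose f hf1 hf2 using h
  have sub : ∀ X Y, f X = f Y → X ⊆ Y := by
    intro X Y e
    obtain ⟨p, hp, h1⟩ := hf1 X
    obtain ⟨q, hq, h2⟩ := hf2 Y
    exact (key X Y).1 ⟨p, hp, q, hq, (reaches_two _ _ _ _ _).2 ⟨f X, h1, e ▸ h2⟩⟩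
  have inj : Function.Injective f := fun X Y e => (sub X Y e).antisymm (sub Y X e.symm)
  have := Fintype.card_le_of_injective f inj
  simpa using this

end YanPaper
end

section
/- For every n ≥ 1, let A_n be the NFW over the two-letter alphabet {a, b} with state set {s_0, …, s_{n−1}}, all states initial and all states final, and transitions: (s_{i+1}, a, s_i) for every 0 ≤ i ≤ n−2, (s_0, a, s_{n−1}), and (s_i, b, s_i) for every 1 ≤ i ≤ n−1 (no b-transition from s_0). Then every NFW accepting the complement {a, b}* \ L(A_n) has at least 2^n states. -/
namespace YanPaper

/-- The NFW `A_n` over the alphabet `{a, b}` with states `s_0, …, s_{n-1}`, all initial and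
all final, with `a`-transitions `s_{i+1} → s_i` and `s_0 → s_{n-1}`, and `b`-self-loops on
every state except `s_0`. -/
def Arot (n : ℕ) : NFW AB (Fin n) where
  I := Set.univ
  Δ := fun p x q =>
    match x with
    | AB.a => p.val = q.val + 1 ∨ (p.val = 0 ∧ q.val = n - 1)
    | AB.b => p = q ∧ p.val ≠ 0
  F := Set.univ

/-- Recursive reachability. -/
def RR {S A : Type*} (Δ : S → A → S → Prop) : S → List A → S → Prop
  | p, [], q => p = q
  | p, a :: w, q => ∃ r, Δ p a r ∧ RR Δ r w q

theorem reaches_iff {S A : Type*} (Δ : S → A → S → Prop) (w : List A) :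
    ∀ p q, Reaches Δ p w q ↔ RR Δ p w q := by
  induction w with
  | nil =>
    intro p q
    constructor
    · rintro ⟨ρ, h1, h2, h3⟩
      match ρ, h1 with
      | [x], _ =>
        simp at h2 h3
        exact h2.symm.trans h3
    · intro h
      exact ⟨[p], trivial, rfl, by simpa [RR] using h⟩
  | cons a w ih =>
    intro p q
    constructor
    · rintro ⟨ρ, h1, h2, h3⟩
      match ρ, h1 with
      | x :: y :: ρ, h1 =>
        simp at h2
        subst h2
        exact ⟨y, h1.1, (ih y q).1 ⟨y :: ρ, h1.2, rfl, by simpa using h3⟩⟩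
    · rintro ⟨r, hr, h⟩
      obtain ⟨ρ, h1, h2, h3⟩ := (ih r q).2 h
      match ρ, h2 with
      | y :: ρ, h2 =>
        simp at h2
        subst h2
        exact ⟨p :: y :: ρ, ⟨hr, h1⟩, rfl, by simpa using h3⟩

theorem RR_append {S A : Type*} (Δ : S → A → S → Prop) (u v : List A) :
    ∀ p q, RR Δ p (u ++ v) q ↔ ∃ r, RR Δ p u r ∧ RR Δ r v q := by
  induction u with
  | nil => intro p q; simp [RR]
  | cons a u ih =>
    intro p q
    simp only [List.cons_append, RR, ih]
    constructor
    · rintro ⟨r, h, s, h1, h2⟩; exact ⟨s, ⟨r, h, h1⟩, h2⟩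
    · rintro ⟨s, ⟨r, h, h1⟩, h2⟩; exact ⟨r, h, s, h1, h2⟩

open Classical in
/-- The word killing exactly the states in `P` during a rotation. -/
noncomputable def WW (P : ℕ → Prop) : ℕ → ℕ → List AB
  | _, 0 => []
  | i, k + 1 => (if P i then [AB.b] else []) ++ AB.a :: WW P (i + 1) k

/-- Position after `i` rotation steps. -/
def posn (n p i : ℕ) : ℕ := if i ≤ p then p - i else p + n - i

theorem RR_WW (n : ℕ) (P : ℕ → Prop) (p : ℕ) (hp : p < n) (q : Fin n) (k : ℕ) :
    ∀ (i : ℕ) (r : Fin n), i + k ≤ n → r.val = posn n p i →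
      (RR (Arot n).Δ r (WW P i k) q ↔
        q.val = posn n p (i + k) ∧ ∀ j, i ≤ j → j < i + k → P j → j ≠ p) := by
  induction k with
  | zero =>
    intro i r hi hr
    simp only [WW, RR, Fin.ext_iff, hr]
    constructor
    · intro h; exact ⟨by simp [h], by intros; omega⟩
    · intro h; simpa using h.1.symm
  | succ k ih =>
    intro i r hi hr
    have hlt : posn n p (i + 1) < n := by unfold posn; split_ifs <;> omega
    have hz : r.val ≠ 0 ↔ i ≠ p := by rw [hr]; unfold posn; split_ifs <;> omega
    have ha : ∀ s : Fin n, (Arot n).Δ r AB.a s ↔ s = ⟨posn n p (i + 1), hlt⟩ := by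
      intro s
      have hs := s.2
      simp only [Arot, Fin.ext_iff, hr]
      unfold posn; split_ifs <;> omega
    have hb : ∀ s : Fin n, (Arot n).Δ r AB.b s ↔ s = r ∧ i ≠ p := by
      intro s
      simp only [Arot]
      rw [hz, eq_comm]
    have key := ih (i + 1) ⟨posn n p (i + 1), hlt⟩ (by omega) rfl
    have e : i + 1 + k = i + (k + 1) := by omega
    rw [e] at key
    have step : RR (Arot n).Δ r (AB.a :: WW P (i + 1) k) q ↔
        RR (Arot n).Δ ⟨posn n p (i + 1), hlt⟩ (WW P (i + 1) k) q := by
      simp only [RR, ha, exists_eq_left]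
    have main : RR (Arot n).Δ r (WW P i (k + 1)) q ↔ (P i → i ≠ p) ∧
        RR (Arot n).Δ ⟨posn n p (i + 1), hlt⟩ (WW P (i + 1) k) q := by
      rw [← step]
      by_cases h : P i
      · simp only [WW, h, if_true, List.cons_append, List.nil_append]
        rw [RR]
        simp only [hb]
        constructor
        · rintro ⟨s, ⟨rfl, h1⟩, h2⟩; exact ⟨fun _ => h1, h2⟩
        · rintro ⟨h1, h2⟩; exact ⟨r, ⟨rfl, h1 trivial⟩, h2⟩
      · simp [WW, h]
    rw [main, key]
    constructor
    · rintro ⟨h1, h2, h3⟩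
      refine ⟨h2, fun j hj hj' hP => ?_⟩
      rcases Nat.eq_or_lt_of_le hj with rfl | h
      · exact h1 hP
      · exact h3 j h hj' hP
    · rintro ⟨h2, h3⟩
      exact ⟨h3 i le_rfl (by omega), h2, fun j hj => h3 j (by omega)⟩

theorem RR_full (n : ℕ) (P : ℕ → Prop) (p q : Fin n) :
    RR (Arot n).Δ p (WW P 0 n) q ↔ q = p ∧ ¬ P p.val := by
  have hp := p.2
  rw [RR_WW n P p.val hp q n 0 p (by omega) (by simp [posn])]
  have : posn n p.val (0 + n) = p.val := by unfold posn; split_ifs <;> omega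
  rw [this, Fin.ext_iff]
  constructor
  · rintro ⟨h1, h2⟩; exact ⟨h1, fun h => h2 p.val (by omega) (by omega) h rfl⟩
  · rintro ⟨h1, h2⟩; exact ⟨h1, fun j _ _ h e => h2 (e ▸ h)⟩

theorem mem_Lang_Arot (n : ℕ) (P Q : ℕ → Prop) :
    WW P 0 n ++ WW Q 0 n ∈ (Arot n).Lang ↔ ∃ p : Fin n, ¬ P p.val ∧ ¬ Q p.val := by
  simp only [NFW.Lang, Set.mem_setOf_eq, reaches_iff, RR_append, RR_full]
  constructor
  · rintro ⟨p, _, q, _, r, ⟨rfl, h1⟩, _, h2⟩; exact ⟨r, h1, h2⟩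
  · rintro ⟨p, h1, h2⟩; exact ⟨p, trivial, p, trivial, p, ⟨rfl, h1⟩, rfl, h2⟩

/-- every NFW accepting the complement of `L(A_n)` has at least `2^n` states. -/
theorem binary_nfw_complementation_lower_bound (n : ℕ) (hn : 1 ≤ n)
    (T : Type) [Fintype T] (C : NFW AB T) (hC : C.Lang = (Arot n).Langᶜ) :
    2 ^ n ≤ Fintype.card T := by
  classical
  let P : Finset (Fin n) → ℕ → Prop := fun S j => ∃ h : j < n, (⟨j, h⟩ : Fin n) ∈ S
  have hP : ∀ S (p : Fin n), P S p.val ↔ p ∈ S := fun S p => ⟨fun ⟨_, h⟩ => h, fun h => ⟨p.2, h⟩⟩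
  have h1 : ∀ S : Finset (Fin n), ∃ t : T,
      (∃ p ∈ C.I, RR C.Δ p (WW (P S) 0 n) t) ∧
      (∃ q ∈ C.F, RR C.Δ t (WW (fun j => ¬ P S j) 0 n) q) := by
    intro S
    have : WW (P S) 0 n ++ WW (fun j => ¬ P S j) 0 n ∈ C.Lang := by
      rw [hC, Set.mem_compl_iff, mem_Lang_Arot]
      rintro ⟨p, h, h'⟩
      exact h' h
    obtain ⟨p, hp, q, hq, h⟩ := this
    rw [reaches_iff, RR_append] at h
    obtain ⟨t, ha, hb⟩ := h
    exact ⟨t, ⟨p, hp, ha⟩, ⟨q, hq, hb⟩⟩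
  choose f hf1 hf2 using h1
  have sub : ∀ S S', f S = f S' → S' ⊆ S := by
    intro S S' e x hx
    by_contra hxS
    obtain ⟨p, hp, ha⟩ := hf1 S
    obtain ⟨q, hq, hb⟩ := hf2 S'
    rw [← e] at hb
    have hmem : WW (P S) 0 n ++ WW (fun j => ¬ P S' j) 0 n ∈ C.Lang :=
      ⟨p, hp, q, hq, (reaches_iff _ _ _ _).2 ((RR_append _ _ _ _ _).2 ⟨_, ha, hb⟩)⟩
    rw [hC, Set.mem_compl_iff, mem_Lang_Arot] at hmem
    exact hmem ⟨x, by rwa [hP], by simpa [hP] using hx⟩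
  have inj : Function.Injective f := fun S S' e =>
    Finset.Subset.antisymm (sub S' S e.symm) (sub S S' e)
  simpa using Fintype.card_le_of_injective f inj

end YanPaper
end

section
/- Let Σ₁ be an alphabet and A₁ = (Σ₁, S, I, Δ₁, F) an NFW with |S| = n. Let A₂ = (𝒫(S × S), S, I, Δ₂, F) be the full NFW over S with the same initial and final states as A₁. Then for every NFW C₂ accepting the complement of L(A₂) there exists an NFW with the same number of states as C₂ accepting the complement of L(A₁). In particular, the minimum number of states of an NFW accepting the complement of L(A₂) is greater than or equal to the minimum number of states of an NFW accepting the complement of L(A₁). -/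
namespace YanPaper

theorem runOn_map {S A B : Type*} (Δ : S → B → S → Prop) (h : A → B) :
    ∀ (w : List A) (ρ : List S),
      RunOn Δ ρ (w.map h) ↔ RunOn (fun p a q => Δ p (h a) q) ρ w
  | [], [] => by simp [RunOn]
  | [], [_] => by simp [RunOn]
  | [], _ :: _ :: _ => by simp [RunOn]
  | _ :: _, [] => by simp [RunOn]
  | _ :: _, [_] => by simp [RunOn]
  | a :: w, p :: q :: ρ => by
    have := runOn_map Δ h w (q :: ρ)
    simp only [List.map_cons, RunOn, this]

theorem mem_lang_map {S A B : Type*} (I F : Set S) (Δ : S → B → S → Prop) (h : A → B)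
    (w : List A) :
    w ∈ (NFW.mk I (fun p a q => Δ p (h a) q) F).Lang ↔ w.map h ∈ (NFW.mk I Δ F).Lang := by
  simp only [NFW.Lang, Reaches, Set.mem_setOf_eq, runOn_map]

theorem reaches_nil {S A : Type*} (Δ : S → A → S → Prop) (p q : S) :
    Reaches Δ p [] q ↔ p = q := by
  constructor
  · rintro ⟨ρ, h, h1, h2⟩
    match ρ, h with
    | [x], _ =>
      simp at h1 h2
      exact h1.symm.trans h2
  · rintro rfl
    exact ⟨[p], by simp [RunOn]⟩

theorem reaches_cons {S A : Type*} (Δ : S → A → S → Prop) (p q : S) (a : A) (w : List A) :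
    Reaches Δ p (a :: w) q ↔ ∃ r, Δ p a r ∧ Reaches Δ r w q := by
  constructor
  · rintro ⟨ρ, h, h1, h2⟩
    match ρ, h with
    | x :: y :: ρ, h =>
      simp at h1
      subst h1
      exact ⟨y, h.1, y :: ρ, h.2, rfl, by simpa [List.getLast?_cons_cons] using h2⟩
  · rintro ⟨r, hr, ρ, h, h1, h2⟩
    match ρ, h1 with
    | y :: ρ, h1 =>
      simp at h1
      subst h1
      exact ⟨p :: y :: ρ, ⟨hr, h⟩, rfl, by simpa [List.getLast?_cons_cons] using h2⟩

theorem reaches_subset {S A T : Type*} (Δ : S → A → S → Prop) (e : T ≃ Set S) (w : List A) :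
    ∀ i j : T, Reaches (fun i a j => e j = {q | ∃ p ∈ e i, Δ p a q}) i w j ↔
      e j = {q | ∃ p ∈ e i, Reaches Δ p w q} := by
  induction w with
  | nil =>
    intro i j
    simp only [reaches_nil, exists_eq_right, Set.setOf_mem_eq]
    rw [e.apply_eq_iff_eq, eq_comm]
  | cons a w ih =>
    intro i j
    simp only [reaches_cons, ih]
    have key : ∀ P : Set S, P = {q | ∃ p ∈ e i, Δ p a q} →
        {q | ∃ p ∈ P, Reaches Δ p w q} = {q | ∃ p ∈ e i, ∃ r, Δ p a r ∧ Reaches Δ r w q} := by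
      rintro P rfl
      ext q
      simp only [Set.mem_setOf_eq]
      constructor
      · rintro ⟨r, ⟨p, hp, h⟩, h'⟩
        exact ⟨p, hp, r, h, h'⟩
      · rintro ⟨p, hp, r, h, h'⟩
        exact ⟨r, ⟨p, hp, h⟩, h'⟩
    constructor
    · rintro ⟨r, hr, h⟩
      rw [h, key _ hr]
    · intro h
      refine ⟨e.symm {q | ∃ p ∈ e i, Δ p a q}, by simp, ?_⟩
      rw [h, key _ (by simp)]

theorem exists_complement {S A : Type*} [Finite S] (M : NFW A S) :
    ∃ c : ℕ, ∃ C : NFW A (Fin c), C.Lang = M.Langᶜ := by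
  obtain ⟨c, ⟨e'⟩⟩ := Finite.exists_equiv_fin (Set S)
  let e := e'.symm
  refine ⟨c, ⟨{e.symm M.I}, fun i a j => e j = {q | ∃ p ∈ e i, M.Δ p a q},
    {j | ∀ q ∈ e j, q ∉ M.F}⟩, ?_⟩
  ext w
  simp only [NFW.Lang, Set.mem_setOf_eq, reaches_subset, Set.mem_compl_iff,
    Set.mem_singleton_iff, exists_eq_left, Equiv.apply_symm_apply]
  constructor
  · rintro ⟨j, hj, h⟩ ⟨p, hp, q, hq, hr⟩
    exact hj q (by rw [h]; exact ⟨p, hp, hr⟩) hq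
  · intro h
    refine ⟨e.symm {q | ∃ p ∈ M.I, Reaches M.Δ p w q}, ?_, by simp⟩
    intro q hq hF
    simp only [Equiv.apply_symm_apply] at hq
    obtain ⟨p, hp, hr⟩ := hq
    exact h ⟨p, hp, q, hF, hr⟩

theorem pull_complement {A₁ S : Type} (I F : Set S) (Δ₁ : S → A₁ → S → Prop)
    (T : Type) (C₂ : NFW (Set (S × S)) T) (hC : C₂.Lang = (FullNFW S I F).Langᶜ) :
    ∃ C₁ : NFW A₁ T, C₁.Lang = (NFW.mk I Δ₁ F).Langᶜ := by
  let h : A₁ → Set (S × S) := fun a => {x | Δ₁ x.1 a x.2}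
  refine ⟨⟨C₂.I, fun p a q => C₂.Δ p (h a) q, C₂.F⟩, ?_⟩
  ext w
  rw [mem_lang_map C₂.I C₂.F C₂.Δ h w]
  change w.map h ∈ C₂.Lang ↔ _
  rw [hC]
  exact not_congr (mem_lang_map I F (FullNFW S I F).Δ h w).symm

/-- reduction of NFW complementation to complementation of full NFWs. -/
theorem nfw_full_automata_reduction (A₁ S : Type) [Fintype S] (n : ℕ)
    (hS : Fintype.card S = n) (I F : Set S) (Δ₁ : S → A₁ → S → Prop) :
    (∀ (T : Type) [Fintype T] (C₂ : NFW (Set (S × S)) T),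
      C₂.Lang = (FullNFW S I F).Langᶜ →
        ∃ C₁ : NFW A₁ T, C₁.Lang = (NFW.mk I Δ₁ F).Langᶜ) ∧
    NFWminStates A₁ (NFW.mk I Δ₁ F).Langᶜ ≤
      NFWminStates (Set (S × S)) (FullNFW S I F).Langᶜ := by
  refine ⟨fun T _ C₂ hC => pull_complement I F Δ₁ T C₂ hC, ?_⟩
  have hne : {c : ℕ | ∃ C : NFW (Set (S × S)) (Fin c),
      C.Lang = (FullNFW S I F).Langᶜ}.Nonempty := exists_complement (FullNFW S I F)
  obtain ⟨C, hC⟩ := Nat.sInf_mem hne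
  exact Nat.sInf_le (pull_complement I F Δ₁ _ C hC)

end YanPaper
end

section
/- Let Σ₁ be an alphabet and A₁ = (Σ₁, S, I, Δ₁, F) an NBW with |S| = n. Let A₂ = (𝒫(S × S), S, I, Δ₂, F) be the full NBW over S with the same initial and final states as A₁. Then for every NBW C₂ accepting the complement of L(A₂) there exists an NBW with the same number of states as C₂ accepting the complement of L(A₁). In particular, the minimum number of states of an NBW accepting the complement of L(A₂) is greater than or equal to the minimum number of states of an NBW accepting the complement of L(A₁). -/
namespace YanPaper

open Classical in
theorem exists_block (i : ℕ → ℕ) (hi : StrictMono i) (h0 : i 0 = 0) :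
    ∃ K : ℕ → ℕ, (∀ m, i (K m) ≤ m ∧ m < i (K m + 1)) := by
  have : ∀ m, ∃ k, i k ≤ m ∧ m < i (k + 1) := by
    intro m
    induction m with
    | zero => exact ⟨0, by omega, by have := hi (Nat.lt_add_one 0); omega⟩
    | succ m ih =>
      obtain ⟨k, h1, h2⟩ := ih
      by_cases h : m + 1 < i (k + 1)
      · exact ⟨k, by omega, h⟩
      · exact ⟨k + 1, by omega, by have := hi (Nat.lt_add_one (k + 1)); omega⟩
  choose K hK using this
  exact ⟨K, hK⟩

theorem block_unique {i : ℕ → ℕ} (hi : StrictMono i) {m k l : ℕ}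
    (h1 : i k ≤ m) (h2 : m < i (k + 1)) (h3 : i l ≤ m) (h4 : m < i (l + 1)) : k = l := by
  have a : k < l + 1 := hi.lt_iff_lt.1 (by omega)
  have b : l < k + 1 := hi.lt_iff_lt.1 (by omega)
  omega

abbrev Prof (S : Type) := Set (S × S) × Set (S × S)

def pstep {A S : Type} (M : NBW A S) (x : Prof S) (a : A) : Prof S :=
  ({z | ∃ r, (z.1, r) ∈ x.1 ∧ M.Δ r a z.2},
   {z | ∃ r, ((z.1, r) ∈ x.2 ∧ M.Δ r a z.2) ∨ ((z.1, r) ∈ x.1 ∧ M.Δ r a z.2 ∧ z.2 ∈ M.F)})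

def pid (S : Type) : Prof S := ({z | z.1 = z.2}, ∅)

def prof {A S : Type} (M : NBW A S) (α : ℕ → A) (i : ℕ) : ℕ → Prof S
  | 0 => pid S
  | d + 1 => pstep M (prof M α i d) (α (i + d))

theorem prof_fst_of {A S : Type} (M : NBW A S) (α : ℕ → A) (i : ℕ) (ρ : ℕ → S) (d : ℕ)
    (h : ∀ m, i ≤ m → m < i + d → M.Δ (ρ m) (α m) (ρ (m + 1))) :
    (ρ i, ρ (i + d)) ∈ (prof M α i d).1 := by
  induction d with
  | zero => simp [prof, pid]
  | succ d ih =>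
    exact ⟨ρ (i + d), ih (fun m h1 h2 => h m h1 (by omega)), h (i + d) (by omega) (by omega)⟩

theorem prof_snd_of {A S : Type} (M : NBW A S) (α : ℕ → A) (i : ℕ) (ρ : ℕ → S) (d : ℕ)
    (h : ∀ m, i ≤ m → m < i + d → M.Δ (ρ m) (α m) (ρ (m + 1)))
    (hF : ∃ m, i < m ∧ m ≤ i + d ∧ ρ m ∈ M.F) :
    (ρ i, ρ (i + d)) ∈ (prof M α i d).2 := by
  induction d with
  | zero => obtain ⟨m, h1, h2, _⟩ := hF; omega
  | succ d ih =>
    have hr : ∀ m, i ≤ m → m < i + d → M.Δ (ρ m) (α m) (ρ (m + 1)) :=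
      fun m h1 h2 => h m h1 (by omega)
    have hs := h (i + d) (by omega) (by omega)
    obtain ⟨m, h1, h2, h3⟩ := hF
    by_cases hm : m ≤ i + d
    · exact ⟨ρ (i + d), Or.inl ⟨ih hr ⟨m, h1, hm, h3⟩, hs⟩⟩
    · have : m = i + d + 1 := by omega
      subst this
      exact ⟨ρ (i + d), Or.inr ⟨prof_fst_of M α i ρ d hr, hs, h3⟩⟩

theorem extend_run {A S : Type} (M : NBW A S) (α : ℕ → A) (i d : ℕ) (σ : ℕ → S) (q : S)
    (h : ∀ m, i ≤ m → m < i + d → M.Δ (σ m) (α m) (σ (m + 1)))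
    (hs : M.Δ (σ (i + d)) (α (i + d)) q) :
    ∃ τ : ℕ → S, (∀ m, m ≤ i + d → τ m = σ m) ∧ τ (i + (d + 1)) = q ∧
      ∀ m, i ≤ m → m < i + (d + 1) → M.Δ (τ m) (α m) (τ (m + 1)) := by
  refine ⟨fun m => if m ≤ i + d then σ m else q, fun m hm => by simp [hm], ?_, ?_⟩
  · simp
  · intro m h1 h2
    by_cases hm : m < i + d
    · have e1 : m ≤ i + d := by omega
      have e2 : m + 1 ≤ i + d := by omega
      simp only [e1, e2, if_true]
      exact h m h1 hm
    · have e : m = i + d := by omega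
      subst e
      simpa using hs

theorem run_of_fst {A S : Type} (M : NBW A S) (α : ℕ → A) (i d : ℕ) (p q : S)
    (h : (p, q) ∈ (prof M α i d).1) :
    ∃ σ : ℕ → S, σ i = p ∧ σ (i + d) = q ∧
      ∀ m, i ≤ m → m < i + d → M.Δ (σ m) (α m) (σ (m + 1)) := by
  induction d generalizing q with
  | zero =>
    have : p = q := h
    exact ⟨fun _ => p, rfl, this, fun m h1 h2 => by omega⟩
  | succ d ih =>
    obtain ⟨r, h1, h2⟩ := h
    obtain ⟨σ, a, b, c⟩ := ih r h1
    subst b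
    obtain ⟨τ, t1, t2, t3⟩ := extend_run M α i d σ q c h2
    exact ⟨τ, by rw [t1 i (by omega), a], t2, t3⟩

theorem run_of_snd {A S : Type} (M : NBW A S) (α : ℕ → A) (i d : ℕ) (p q : S)
    (h : (p, q) ∈ (prof M α i d).2) :
    ∃ σ : ℕ → S, σ i = p ∧ σ (i + d) = q ∧
      (∀ m, i ≤ m → m < i + d → M.Δ (σ m) (α m) (σ (m + 1))) ∧
      ∃ m, i < m ∧ m ≤ i + d ∧ σ m ∈ M.F := by
  induction d generalizing q with
  | zero => exact absurd h (by simp [prof, pid])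
  | succ d ih =>
    obtain ⟨r, ⟨h1, h2⟩ | ⟨h1, h2, h3⟩⟩ := h
    · obtain ⟨σ, a, b, c, m, m1, m2, m3⟩ := ih r h1
      subst b
      obtain ⟨τ, t1, t2, t3⟩ := extend_run M α i d σ q c h2
      exact ⟨τ, by rw [t1 i (by omega), a], t2, t3, m, m1, by omega, by rwa [t1 m m2]⟩
    · obtain ⟨σ, a, b, c⟩ := run_of_fst M α i d p r h1
      subst b
      obtain ⟨τ, t1, t2, t3⟩ := extend_run M α i d σ q c h2
      exact ⟨τ, by rw [t1 i (by omega), a], t2, t3, i + (d + 1), by omega, le_rfl,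
        by rwa [t2]⟩

theorem infOcc_nonempty_of {S : Type} [Finite S] (F : Set S) (ρ : ℕ → S)
    (h : ∀ N, ∃ m, N ≤ m ∧ ρ m ∈ F) : (InfOcc ρ ∩ F).Nonempty := by
  by_contra hne
  have : ∀ s : S, ∃ n, s ∈ F → ∀ m, n ≤ m → ρ m ≠ s := by
    intro s
    by_contra hc
    push Not at hc
    exact hne ⟨s, fun n => (hc n).2, (hc 0).1⟩
  choose b hb using this
  obtain ⟨B, hB⟩ := (Set.finite_range b).bddAbove
  obtain ⟨m, h1, h2⟩ := h B
  exact hb (ρ m) h2 m (le_trans (hB ⟨_, rfl⟩) h1) rfl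

theorem key {A S : Type} [Finite S] (M : NBW A S) (α β : ℕ → A) (i j : ℕ → ℕ)
    (hi : StrictMono i) (hj : StrictMono j) (i0 : i 0 = 0) (j0 : j 0 = 0)
    (h : ∀ k, prof M α (i k) (i (k + 1) - i k) = prof M β (j k) (j (k + 1) - j k))
    (hα : α ∈ M.Lang) : β ∈ M.Lang := by
  obtain ⟨ρ, r0, r1, s, hs, hsF⟩ := hα
  have hi' : ∀ k, i k < i (k + 1) := fun k => hi (Nat.lt_add_one k)
  have hj' : ∀ k, j k < j (k + 1) := fun k => hj (Nat.lt_add_one k)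
  have hσ : ∀ k, ∃ σ : ℕ → S, σ (j k) = ρ (i k) ∧ σ (j (k + 1)) = ρ (i (k + 1)) ∧
      (∀ m, j k ≤ m → m < j (k + 1) → M.Δ (σ m) (β m) (σ (m + 1))) ∧
      ((∃ m, i k < m ∧ m ≤ i (k + 1) ∧ ρ m ∈ M.F) →
        ∃ m, j k < m ∧ m ≤ j (k + 1) ∧ σ m ∈ M.F) := by
    intro k
    have ei : i k + (i (k + 1) - i k) = i (k + 1) := by have := hi' k; omega
    have ej : j k + (j (k + 1) - j k) = j (k + 1) := by have := hj' k; omega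
    by_cases hF : ∃ m, i k < m ∧ m ≤ i (k + 1) ∧ ρ m ∈ M.F
    · have := prof_snd_of M α (i k) ρ (i (k + 1) - i k) (fun m _ _ => r1 m) (by rwa [ei])
      rw [h, ei] at this
      obtain ⟨σ, a, b, c, d⟩ := run_of_snd _ _ _ _ _ _ this
      rw [ej] at b c d
      exact ⟨σ, a, b, c, fun _ => d⟩
    · have := prof_fst_of M α (i k) ρ (i (k + 1) - i k) (fun m _ _ => r1 m)
      rw [h, ei] at this
      obtain ⟨σ, a, b, c⟩ := run_of_fst _ _ _ _ _ _ this
      rw [ej] at b c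
      exact ⟨σ, a, b, c, fun d => absurd d hF⟩
  choose σ s1 s2 s3 s4 using hσ
  obtain ⟨K, hK⟩ := exists_block j hj j0
  obtain ⟨L, hL⟩ := exists_block i hi i0
  have hKj : ∀ k, K (j k) = k := fun k =>
    block_unique hj (hK _).1 (hK _).2 le_rfl (hj' k)
  have hstep : ∀ m, σ (K (m + 1)) (m + 1) = σ (K m) (m + 1) := by
    intro m
    by_cases hm : m + 1 < j (K m + 1)
    · rw [block_unique hj (hK (m + 1)).1 (hK (m + 1)).2 (l := K m)
        (by have := (hK m).1; omega) hm]
    · have e : m + 1 = j (K m + 1) := by have := (hK m).2; omega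
      have e2 : K (m + 1) = K m + 1 := by rw [e, hKj]
      rw [e2, e, s1, s2]
  refine ⟨fun m => σ (K m) m, ?_, ?_, ?_⟩
  · have : K 0 = 0 := by have := hKj 0; rwa [j0] at this
    have h2 := s1 0
    rw [j0, i0] at h2
    simpa [this, h2] using r0
  · intro m
    show M.Δ (σ (K m) m) (β m) (σ (K (m + 1)) (m + 1))
    rw [hstep]
    exact s3 _ _ (hK m).1 (hK m).2
  · apply infOcc_nonempty_of
    intro N
    obtain ⟨m, hm1, hm2⟩ := hs (i N + 1)
    obtain ⟨m, rfl⟩ : ∃ m', m = m' + 1 := ⟨m - 1, by omega⟩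
    obtain ⟨l1, l2⟩ := hL m
    have hN : N < L m + 1 := hi.lt_iff_lt.1 (by omega)
    obtain ⟨m', a, b, c⟩ := s4 (L m) ⟨m + 1, by omega, by omega, by
      show ρ (m + 1) ∈ M.F
      rw [hm2]; exact hsF⟩
    obtain ⟨m', rfl⟩ : ∃ m'', m' = m'' + 1 := ⟨m' - 1, by omega⟩
    have : K m' = L m := block_unique hj (hK _).1 (hK _).2 (by omega) (by omega)
    refine ⟨m' + 1, by have := hj.le_apply (x := L m); omega, ?_⟩
    show σ (K (m' + 1)) (m' + 1) ∈ M.F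
    rw [hstep, this]
    exact c

theorem ramsey {P : Type} [Finite P] (col : ℕ → ℕ → P) :
    ∃ (g : ℕ → ℕ) (e : P), StrictMono g ∧ 0 < g 0 ∧ ∀ k, col (g k) (g (k + 1)) = e := by
  let U : Ultrafilter ℕ := Filter.hyperfilter ℕ
  have hfin : ∀ f : ℕ → P, ∃ c, ∀ᶠ j in (U : Filter ℕ), f j = c := by
    intro f
    obtain ⟨c, hc⟩ := Ultrafilter.eq_pure_of_finite (U.map f)
    refine ⟨c, ?_⟩
    have : ({c} : Set P) ∈ U.map f := by rw [hc]; exact Set.mem_singleton c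
    exact this
  choose c hc using fun i => hfin (col i)
  obtain ⟨e, he⟩ := hfin c
  have hgt : ∀ i, ∀ᶠ j in (U : Filter ℕ), i < j := by
    intro i
    have : ∀ᶠ j in Filter.atTop, i < j := Filter.eventually_gt_atTop i
    rw [← Nat.cofinite_eq_atTop] at this
    exact Filter.hyperfilter_le_cofinite this
  have hnext : ∀ i : {i // c i = e}, ∃ j : {i // c i = e}, i.1 < j.1 ∧ col i.1 j.1 = e := by
    rintro ⟨i, hi⟩
    obtain ⟨j, ⟨h1, h2⟩, h3⟩ := (((hgt i).and (hc i)).and he).exists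
    exact ⟨⟨j, h3⟩, h1, by rw [h2, hi]⟩
  choose nx hn1 hn2 using hnext
  obtain ⟨i0, h1, h2⟩ := ((hgt 0).and he).exists
  let G : ℕ → {i // c i = e} := fun k => Nat.rec ⟨i0, h2⟩ (fun _ x => nx x) k
  exact ⟨fun k => (G k).1, e, strictMono_nat_of_lt_succ (fun k => hn1 (G k)), h1,
    fun k => hn2 (G k)⟩

structure CState (S : Type) where
  c : Prof S
  e : Prof S
  x : Prof S
  f : Bool

instance (S : Type) [Finite S] : Finite (CState S) := by
  apply Finite.of_injective (β := Prof S × Prof S × Prof S × Bool)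
    (fun t => (t.c, t.e, t.x, t.f))
  rintro ⟨_, _, _, _⟩ ⟨_, _, _, _⟩ h
  simp_all

def Fac {A S : Type} (M : NBW A S) (s e : Prof S) (α : ℕ → A) (i : ℕ → ℕ) : Prop :=
  StrictMono i ∧ i 0 = 0 ∧
    ∀ k, prof M α (i k) (i (k + 1) - i k) = if k = 0 then s else e

def compl {A S : Type} (M : NBW A S) : NBW A (CState S) where
  I := {t | t.x = pid S ∧ t.f = true ∧ ∃ α i, α ∉ M.Lang ∧ Fac M t.c t.e α i}
  Δ := fun t a u => u.e = t.e ∧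
    ((u.f = false ∧ u.c = t.c ∧ u.x = pstep M t.x a) ∨
     (u.f = true ∧ u.c = t.e ∧ u.x = pid S ∧ pstep M t.x a = t.c))
  F := {t | t.f = true}

theorem compl_lang {A S : Type} [Finite S] (M : NBW A S) : (compl M).Lang = M.Langᶜ := by
  ext α
  constructor
  · rintro ⟨t, ⟨hx, hf, β, j, hβ, hj, j0, hjp⟩, hΔ, s, hs, hsF⟩ hα
    have hinf : {m | (t m).f = true}.Infinite := by
      rw [Set.infinite_iff_exists_gt]
      intro n
      obtain ⟨m, h1, h2⟩ := hs (n + 1)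
      exact ⟨m, by show (t m).f = true; rw [h2]; exact hsF, by omega⟩
    set i := Nat.nth (fun m => (t m).f = true) with hidef
    have hi : StrictMono i := Nat.nth_strictMono hinf
    have hif : ∀ k, (t (i k)).f = true := fun k => Nat.nth_mem_of_infinite hinf k
    have i0 : i 0 = 0 := Nat.nth_zero_of_zero hf
    have hno : ∀ k m, i k < m → m < i (k + 1) → (t m).f = false := by
      intro k m h1 h2
      by_contra hc
      have hc : (t m).f = true := by simpa using hc
      have := Nat.lt_nth_iff_count_lt (p := fun m => (t m).f = true) hinf (a := m) (b := k + 1)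
      obtain ⟨l, hl⟩ : ∃ l, i l = m := by
        have := Nat.range_nth_of_infinite hinf
        have h3 : m ∈ Set.range i := by rw [hidef, this]; exact hc
        exact h3
      subst hl
      have a := hi.lt_iff_lt.1 h1
      have b := hi.lt_iff_lt.1 h2
      omega
    have he : ∀ m, (t m).e = (t 0).e := by
      intro m
      induction m with
      | zero => rfl
      | succ m ih => rw [(hΔ m).1, ih]
    have hxk : ∀ k, (t (i k)).x = pid S := by
      intro k
      rcases Nat.eq_zero_or_pos (i k) with h | h
      · rw [h]; exact hx
      · obtain ⟨m, hm⟩ : ∃ m, i k = m + 1 := ⟨i k - 1, by omega⟩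
        have := hif k
        rw [hm] at this ⊢
        rcases (hΔ m).2 with h | h
        · simp [h.1] at this
        · exact h.2.2.1
    have hck : ∀ k, (t (i k)).c = if k = 0 then (t 0).c else (t 0).e := by
      intro k
      by_cases hk : k = 0
      · subst hk; simp [i0]
      · have h : 0 < i k := by
          have := hi (Nat.pos_of_ne_zero hk); omega
        obtain ⟨m, hm⟩ : ∃ m, i k = m + 1 := ⟨i k - 1, by omega⟩
        have := hif k
        rw [hm] at this ⊢
        rcases (hΔ m).2 with h | h
        · simp [h.1] at this
        · rw [h.2.1, he]; simp [hk]
    have hseg : ∀ k d, i k + d < i (k + 1) →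
        (t (i k + d)).x = prof M α (i k) d ∧ (t (i k + d)).c = (t (i k)).c := by
      intro k d
      induction d with
      | zero => intro _; exact ⟨hxk k, rfl⟩
      | succ d ih =>
        intro hd
        obtain ⟨a, b⟩ := ih (by omega)
        have hff := hno k (i k + (d + 1)) (by omega) hd
        rcases (hΔ (i k + d)).2 with h | h
        · refine ⟨?_, ?_⟩
          · show (t (i k + d + 1)).x = _
            rw [h.2.2, a]; rfl
          · show (t (i k + d + 1)).c = _
            rw [h.2.1, b]
        · have h1 := h.1
          rw [show i k + d + 1 = i k + (d + 1) from rfl, hff] at h1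
          simp at h1
    apply hβ
    refine key M α β i j hi hj i0 j0 (fun k => ?_) hα
    rw [hjp, ← hck]
    have hlt : i k < i (k + 1) := hi (Nat.lt_add_one k)
    obtain ⟨d, hd⟩ : ∃ d, i (k + 1) = i k + d + 1 := ⟨i (k + 1) - i k - 1, by omega⟩
    obtain ⟨a, b⟩ := hseg k d (by omega)
    have hff := hif (k + 1)
    rw [hd] at hff
    have e : i (k + 1) - i k = d + 1 := by omega
    rw [e]
    rcases (hΔ (i k + d)).2 with h | h
    · rw [h.1] at hff; simp at hff
    · rw [← b, ← h.2.2.2, a]; rfl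
  · intro hα
    obtain ⟨g, e, hg, g0, hge⟩ := ramsey (fun a b => prof M α a (b - a))
    let i : ℕ → ℕ := fun k => Nat.casesOn k 0 g
    have hi : StrictMono i := by
      apply strictMono_nat_of_lt_succ
      intro k
      cases k with
      | zero => exact g0
      | succ k => exact hg (Nat.lt_add_one k)
    have i0 : i 0 = 0 := rfl
    let s := prof M α 0 (g 0)
    let cc : ℕ → Prof S := fun k => if k = 0 then s else e
    have hfac : ∀ k, prof M α (i k) (i (k + 1) - i k) = cc k := by
      intro k
      cases k with
      | zero => rfl
      | succ k => simpa [cc] using hge k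
    clear_value i
    obtain ⟨K, hK⟩ := exists_block i hi i0
    have hi' : ∀ k, i k < i (k + 1) := fun k => hi (Nat.lt_add_one k)
    have hKi : ∀ k, K (i k) = k := fun k =>
      block_unique hi (hK _).1 (hK _).2 le_rfl (hi' k)
    have hK0 : K 0 = 0 := by
      have := hKi 0
      rwa [i0] at this
    refine ⟨fun m : ℕ => CState.mk (cc (K m)) e (prof M α (i (K m)) (m - i (K m)))
      (@decide (m = i (K m)) (instDecidableEqNat m (i (K m)))),
      ⟨?_, ?_, ?_⟩, ?_, ?_⟩
    · simp [hK0, i0, prof]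
    · simp [hK0, i0]
    · exact ⟨α, i, hα, hi, i0, by simpa [hK0, cc] using hfac⟩
    · intro m
      obtain ⟨k1, k2⟩ := hK m
      have hps : pstep M (prof M α (i (K m)) (m - i (K m))) (α m) =
          prof M α (i (K m)) (m + 1 - i (K m)) := by
        rw [show m + 1 - i (K m) = (m - i (K m)) + 1 by omega]
        show _ = pstep M _ (α (i (K m) + (m - i (K m))))
        rw [show i (K m) + (m - i (K m)) = m by omega]
      refine ⟨rfl, ?_⟩
      by_cases hm : m + 1 < i (K m + 1)
      · left
        have hk : K (m + 1) = K m := block_unique hi (hK (m + 1)).1 (hK (m + 1)).2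
          (by omega) hm
        refine ⟨?_, ?_, ?_⟩
        · simp only [hk, decide_eq_false_iff_not]; omega
        · simp only [hk]
        · simp only [hk, hps]
      · right
        have hm1 : m + 1 = i (K m + 1) := by omega
        have hk : K (m + 1) = K m + 1 := by rw [hm1, hKi]
        refine ⟨?_, ?_, ?_, ?_⟩
        · simp only [hk, decide_eq_true_eq]; exact hm1
        · simp [hk, cc]
        · simp [hk, ← hm1, prof]
        · simp only [hps]
          rw [hm1, hfac]
    · apply infOcc_nonempty_of
      intro N
      exact ⟨i N, hi.le_apply, by simp [compl, hKi]⟩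

theorem transport {A T : Type} [Finite T] (C : NBW A T) :
    ∃ (c : ℕ) (D : NBW A (Fin c)), D.Lang = C.Lang := by
  obtain ⟨c, ⟨φ⟩⟩ := Finite.exists_equiv_fin T
  refine ⟨c, ⟨{t | φ.symm t ∈ C.I}, fun p a q => C.Δ (φ.symm p) a (φ.symm q),
    {t | φ.symm t ∈ C.F}⟩, ?_⟩
  ext α
  constructor
  · rintro ⟨ρ, h1, h2, s, h3, h4⟩
    refine ⟨fun m => φ.symm (ρ m), h1, h2, φ.symm s, fun n => ?_, h4⟩
    obtain ⟨m, a, b⟩ := h3 n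
    exact ⟨m, a, by simp [b]⟩
  · rintro ⟨ρ, h1, h2, s, h3, h4⟩
    refine ⟨fun m => φ (ρ m), by simpa using h1, by simpa using h2, φ s, fun n => ?_,
      by simpa using h4⟩
    obtain ⟨m, a, b⟩ := h3 n
    exact ⟨m, a, by simp [b]⟩

/-- reduction of NBW complementation to complementation of full NBWs. -/
theorem nbw_full_automata_reduction (A₁ S : Type) [Fintype S] (n : ℕ)
    (hS : Fintype.card S = n) (I F : Set S) (Δ₁ : S → A₁ → S → Prop) :
    (∀ (T : Type) [Fintype T] (C₂ : NBW (Set (S × S)) T),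
      C₂.Lang = (FullNBW S I F).Langᶜ →
        ∃ C₁ : NBW A₁ T, C₁.Lang = (NBW.mk I Δ₁ F).Langᶜ) ∧
    NBWminStates A₁ (NBW.mk I Δ₁ F).Langᶜ ≤
      NBWminStates (Set (S × S)) (FullNBW S I F).Langᶜ := by
  have main : ∀ (T : Type) (C₂ : NBW (Set (S × S)) T),
      C₂.Lang = (FullNBW S I F).Langᶜ →
        ∃ C₁ : NBW A₁ T, C₁.Lang = (NBW.mk I Δ₁ F).Langᶜ := by
    intro T C₂ h
    refine ⟨⟨C₂.I, fun p a q => C₂.Δ p {z | Δ₁ z.1 a z.2} q, C₂.F⟩, ?_⟩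
    ext α
    exact Set.ext_iff.1 h (fun m => {z | Δ₁ z.1 (α m) z.2})
  refine ⟨fun T _ C₂ h => main T C₂ h, ?_⟩
  have hne : {c : ℕ | ∃ C : NBW (Set (S × S)) (Fin c),
      C.Lang = (FullNBW S I F).Langᶜ}.Nonempty := by
    obtain ⟨c, D, hD⟩ := transport (compl (FullNBW S I F))
    exact ⟨c, D, by rw [hD, compl_lang]⟩
  obtain ⟨C₂, h⟩ := Nat.sInf_mem hne
  exact Nat.sInf_le (main _ C₂ h)

end YanPaper
end

section
/- Let A = (Σ, S, I, Δ, F) be an NBW with |S| = n and let α ∈ Σ^ω. If there exists an odd C-ranking for the Δ-graph of α under A, then α is not accepted by A. -/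
namespace YanPaper

/-- if there exists an odd C-ranking for the Δ-graph of `α` under the
NBW `M`, then `α` is not accepted by `M`. -/
theorem odd_cranking_not_accepted (A S : Type) [Fintype S] (n : ℕ)
    (hS : Fintype.card S = n) (M : NBW A S) (α : ℕ → A)
    (f : S → ℕ → Option ℕ) (hf : CRanking M α f) (hodd : OddCRanking M α f) :
    α ∉ M.Lang := by
  rintro ⟨ρ, h0, hΔ, q, hq, hqF⟩
  obtain ⟨-, hdef, hF, hmono⟩ := hf
  have hg : ∀ l, ∃ r, f (ρ l) l = some r := fun l =>
    Option.isSome_iff_exists.mp ((hdef (ρ l) l).mpr ⟨ρ, h0, fun i _ => hΔ i, rfl⟩)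
  choose g hg using hg
  have hanti : Antitone g := antitone_nat_of_succ_le fun l =>
    hmono (ρ l) l (ρ (l + 1)) (hΔ l) _ _ (hg l) (hg (l + 1))
  obtain ⟨N, hN⟩ : ∃ N, ∀ l, g N ≤ g l :=
    ⟨Function.argmin g, fun l => Function.argmin_le g l⟩
  have hc : ∀ l, N ≤ l → g l = g N := fun l hl => le_antisymm (hanti hl) (hN l)
  obtain ⟨l, hl, r, hr, hro⟩ := hodd ρ h0 hΔ N
  obtain ⟨m, hm, hmq⟩ := hq N
  have hrl : g l = r := Option.some.inj ((hg l).symm.trans hr)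
  have hgm : Odd (g m) := by rw [hc m hm, ← hc l hl, hrl]; exact hro
  exact hF (ρ m) m _ (hg m) hgm (hmq ▸ hqF)

end YanPaper
end

section
/- For every n > 1, every 1 ≤ m < n, and every pair f, g of Q(m)-rankings for FB_n, there exists an (f, g)-segment for FB_n, i.e., a nonempty finite word w ∈ Σ_n* satisfying properties (P1), (P2) and (P3). -/
namespace YanPaper

theorem head?_of_runOn_ne {S A : Type*} {Δ : S → A → S → Prop} {w : List A}
    (h : RunOn Δ [] w) : False := by
  cases w <;> simp [RunOn] at h

theorem rv_nil {S A : Type*} (Δ : S → A → S → Prop) (T : Set S) (p q : S) :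
    ReachesVisit Δ T p [] q ↔ p = q ∧ p ∈ T := by
  constructor
  · rintro ⟨ρ, h, h1, h2, h3⟩
    match ρ, h with
    | [x], _ => simp_all
  · rintro ⟨rfl, h⟩
    exact ⟨[p], by simp [RunOn, h]⟩

theorem rv_cons {S A : Type*} (Δ : S → A → S → Prop) (T : Set S) (p q : S) (a : A)
    (w : List A) :
    ReachesVisit Δ T p (a :: w) q ↔
      ∃ r, Δ p a r ∧ ((p ∈ T ∧ Reaches Δ r w q) ∨ ReachesVisit Δ T r w q) := by
  constructor
  · rintro ⟨ρ, h, h1, h2, s, hs, hT⟩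
    match ρ, h with
    | x :: y :: ρ, h =>
      simp only [List.head?_cons, Option.some.injEq] at h1
      subst h1
      refine ⟨y, h.1, ?_⟩
      rcases List.mem_cons.1 hs with rfl | hs
      · exact Or.inl ⟨hT, y :: ρ, h.2, rfl, by simpa using h2⟩
      · exact Or.inr ⟨y :: ρ, h.2, rfl, by simpa using h2, s, hs, hT⟩
  · rintro ⟨r, hr, ⟨hp, ρ, h, h1, h2⟩ | ⟨ρ, h, h1, h2, s, hs, hT⟩⟩
    · match ρ, h with
      | [], h => simp at h1
      | y :: ρ, h =>
        simp only [List.head?_cons, Option.some.injEq] at h1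
        subst h1
        exact ⟨p :: y :: ρ, ⟨hr, h⟩, rfl, by simpa using h2, p, by simp, hp⟩
    · match ρ, h with
      | [], h => simp at h1
      | y :: ρ, h =>
        simp only [List.head?_cons, Option.some.injEq] at h1
        subst h1
        exact ⟨p :: y :: ρ, ⟨hr, h⟩, rfl, by simpa using h2, s, List.mem_cons_of_mem _ hs, hT⟩

theorem rv_reaches {S A : Type*} {Δ : S → A → S → Prop} {T : Set S} {p q : S} {w : List A}
    (h : ReachesVisit Δ T p w q) : Reaches Δ p w q := by
  obtain ⟨ρ, h, h1, h2, -⟩ := h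
  exact ⟨ρ, h, h1, h2⟩

theorem rv_of_mem {S A : Type*} {Δ : S → A → S → Prop} {T : Set S} {p q : S} {w : List A}
    (h : Reaches Δ p w q) (hp : p ∈ T) : ReachesVisit Δ T p w q := by
  obtain ⟨ρ, h, h1, h2⟩ := h
  exact ⟨ρ, h, h1, h2, p, List.mem_of_mem_head? h1, hp⟩

theorem reaches_append {S A : Type*} (Δ : S → A → S → Prop) (u w : List A) (p q : S) :
    Reaches Δ p (u ++ w) q ↔ ∃ r, Reaches Δ p u r ∧ Reaches Δ r w q := by
  induction u generalizing p with
  | nil => simp [reaches_nil]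
  | cons a u ih =>
    simp only [List.cons_append, reaches_cons, ih]
    grind

theorem rv_append {S A : Type*} (Δ : S → A → S → Prop) (T : Set S) (u w : List A) (p q : S) :
    ReachesVisit Δ T p (u ++ w) q ↔
      ∃ r, (ReachesVisit Δ T p u r ∧ Reaches Δ r w q) ∨
        (Reaches Δ p u r ∧ ReachesVisit Δ T r w q) := by
  induction u generalizing p with
  | nil =>
    simp only [List.nil_append, reaches_nil, rv_nil]
    constructor
    · intro h
      exact ⟨p, Or.inr ⟨rfl, h⟩⟩
    · rintro ⟨r, ⟨⟨rfl, hp⟩, h⟩ | ⟨rfl, h⟩⟩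
      · exact rv_of_mem h hp
      · exact h
  | cons a u ih =>
    simp only [List.cons_append, reaches_cons, rv_cons, ih, reaches_append]
    grind

def letJ (n : ℕ) : FBAlpha n := {x | ∃ i, x = (some i, some i)}

def letA (n : ℕ) (f : Fin (n - 1) → ℕ) (t : ℕ) : FBAlpha n :=
  {x | ∃ i, x.1 = some i ∧ (x.2 = some i ∨ (x.2 = none ∧ t ≤ f i))}

def letB (n : ℕ) (f : Fin (n - 1) → ℕ) (t : ℕ) : FBAlpha n :=
  {x | ∃ j, x.2 = some j ∧ (x.1 = some j ∨ (x.1 = none ∧ f j < t))}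

def letM (n : ℕ) (f g : Fin (n - 1) → ℕ) : FBAlpha n :=
  {x | ∃ i j, x = (some i, some j) ∧ f i = g j ∧ Odd (f i)}

def desc (n : ℕ) (f : Fin (n - 1) → ℕ) : ℕ → List (FBAlpha n)
  | 0 => [letJ n]
  | t + 1 => desc n f t ++ [letA n f t, letB n f t]

theorem reaches_pair (n : ℕ) (f : Fin (n - 1) → ℕ) (t : ℕ) (p q : FBState n) :
    Reaches (FB n).Δ p [letA n f t, letB n f t] q ↔
      ∃ i j, p = some i ∧ q = some j ∧ (i = j ∨ (f j < t ∧ t ≤ f i)) := by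
  simp only [reaches_cons, reaches_nil, FB, letA, letB, Set.mem_setOf_eq]
  constructor
  · rintro ⟨r, ⟨i, hp, h⟩, s, ⟨j, hs, h'⟩, rfl⟩
    refine ⟨i, j, hp, hs, ?_⟩
    rcases h with h | h <;> rcases h' with h' | h' <;> simp_all
  · rintro ⟨i, j, rfl, rfl, rfl | ⟨h1, h2⟩⟩
    · exact ⟨some i, by simp⟩
    · exact ⟨none, by simp [h1, h2]⟩

theorem rv_pair (n : ℕ) (f : Fin (n - 1) → ℕ) (t : ℕ) (p q : FBState n) :
    ReachesVisit (FB n).Δ {none} p [letA n f t, letB n f t] q ↔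
      ∃ i j, p = some i ∧ q = some j ∧ (f j < t ∧ t ≤ f i) := by
  simp only [rv_cons, rv_nil, reaches_cons, reaches_nil, FB, letA, letB, Set.mem_setOf_eq,
    Set.mem_singleton_iff]
  constructor
  · rintro ⟨r, ⟨i, hp, h⟩, h''⟩
    rcases h'' with ⟨rfl, _⟩ | ⟨s, ⟨j, hs, h'⟩, h''⟩
    · simp at hp
    · have : q = s := by grind
      subst this
      refine ⟨i, j, hp, hs, ?_⟩
      rcases h with h | h <;> rcases h' with h' | h' <;> simp_all
  · rintro ⟨i, j, rfl, rfl, h1, h2⟩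
    exact ⟨none, by simp [h1, h2]⟩

theorem reaches_desc (n : ℕ) (f : Fin (n - 1) → ℕ) (t : ℕ) (p q : FBState n) :
    Reaches (FB n).Δ p (desc n f t) q ↔
      ∃ i j, p = some i ∧ q = some j ∧ (i = j ∨ (f j < f i ∧ f j + 1 < t)) := by
  induction t generalizing q with
  | zero =>
    simp only [desc, reaches_cons, reaches_nil, FB, letJ, Set.mem_setOf_eq]
    grind
  | succ t ih =>
    simp only [desc, reaches_append, ih, reaches_pair]
    constructor
    · rintro ⟨r, ⟨i, k, rfl, rfl, h⟩, k', j, hk, rfl, h'⟩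
      grind
    · rintro ⟨i, j, rfl, rfl, h⟩
      by_cases hh : i = j ∨ (f j < f i ∧ f j + 1 < t)
      · exact ⟨some j, ⟨i, j, rfl, rfl, hh⟩, j, j, rfl, rfl, Or.inl rfl⟩
      · exact ⟨some i, ⟨i, i, rfl, rfl, Or.inl rfl⟩, i, j, rfl, rfl, by grind⟩

theorem rv_desc (n : ℕ) (f : Fin (n - 1) → ℕ) (t : ℕ) (p q : FBState n) :
    ReachesVisit (FB n).Δ {none} p (desc n f t) q ↔
      ∃ i j, p = some i ∧ q = some j ∧ (f j < f i ∧ f j + 1 < t) := by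
  induction t generalizing q with
  | zero =>
    simp only [desc, rv_cons, rv_nil, reaches_nil, FB, letJ, Set.mem_setOf_eq,
      Set.mem_singleton_iff]
    grind
  | succ t ih =>
    simp only [desc, rv_append, ih, reaches_pair, rv_pair, reaches_desc]
    constructor
    · rintro ⟨r, ⟨⟨i, k, rfl, rfl, h⟩, k', j, hk, rfl, h'⟩ |
        ⟨⟨i, k, rfl, rfl, h⟩, k', j, hk, rfl, h'⟩⟩ <;> grind
    · rintro ⟨i, j, rfl, rfl, h⟩
      by_cases hh : (f j < f i ∧ f j + 1 < t)
      · exact ⟨some j, Or.inl ⟨⟨i, j, rfl, rfl, hh⟩, j, j, rfl, rfl, Or.inl rfl⟩⟩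
      · exact ⟨some i, Or.inr ⟨⟨i, i, rfl, rfl, Or.inl rfl⟩, i, j, rfl, rfl, by grind⟩⟩

theorem reaches_letM (n : ℕ) (f g : Fin (n - 1) → ℕ) (p q : FBState n) :
    Reaches (FB n).Δ p [letM n f g] q ↔
      ∃ i j, p = some i ∧ q = some j ∧ f i = g j ∧ Odd (f i) := by
  simp only [reaches_cons, reaches_nil, FB, letM, Set.mem_setOf_eq]
  grind

theorem rv_letM (n : ℕ) (f g : Fin (n - 1) → ℕ) (p q : FBState n) :
    ¬ ReachesVisit (FB n).Δ {none} p [letM n f g] q := by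
  simp only [rv_cons, rv_nil, reaches_nil, FB, letM, Set.mem_setOf_eq, Set.mem_singleton_iff]
  grind

/-- for all `n > 1`, `1 ≤ m < n`, and `Q(m)`-rankings `f, g` for `FB n`,
there exists an `(f, g)`-segment for `FB n`. -/
theorem exists_fg_segment (n m : ℕ) (hn : 1 < n) (hm : 1 ≤ m) (hmn : m < n)
    (f g : Fin (n - 1) → ℕ) (hf : QRanking n m f) (hg : QRanking n m g) :
    ∃ w : List (FBAlpha n), IsSeg n f g w := by
  have key : ∀ i j : Fin (n - 1), g j < f i →
      ∃ k l, f k = g l ∧ Odd (f k) ∧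
        ((f k < f i ∧ (l = j ∨ g j < g l)) ∨ (k = i ∧ g j < g l)) := by
    intro i j hij
    have hi := hf.1 i
    rcases Nat.even_or_odd (f i) with he | ho
    · have ho : Odd (f i - 1) := by
        obtain ⟨c, hc⟩ := he
        exact ⟨c - 1, by omega⟩
      obtain ⟨k, hk⟩ := hf.2 (f i - 1) (by omega) ho
      by_cases hj : g j = f i - 1
      · exact ⟨k, j, by omega, hk ▸ ho, Or.inl ⟨by omega, Or.inl rfl⟩⟩
      · obtain ⟨l, hl⟩ := hg.2 (f i - 1) (by omega) ho
        exact ⟨k, l, by omega, hk ▸ ho, Or.inl ⟨by omega, Or.inr (by omega)⟩⟩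
    · obtain ⟨l, hl⟩ := hg.2 (f i) hi ho
      exact ⟨i, l, hl.symm, ho, Or.inr ⟨rfl, by omega⟩⟩
  refine ⟨desc n f (2 * m + 1) ++ ([letM n f g] ++ desc n g (2 * m + 1)), by simp, ?_, ?_, ?_⟩
  · intro p q
    simp only [reaches_append, reaches_desc, reaches_letM]
    constructor
    · rintro ⟨_, ⟨i, k, hi, rfl, h1⟩, _, ⟨k', l, hk, rfl, h2⟩, l', j, hl, hj, h3⟩
      simp only [Option.some.injEq] at hi hk hl hj
      subst hi hk hl hj
      rcases h1 with rfl | h1 <;> rcases h3 with rfl | h3 <;> grind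
    · rintro (h | ⟨h, ho⟩)
      · obtain ⟨k, l, hkl, ho, hh⟩ := key p q h
        have := hf.1 k
        have := hf.1 p
        have := hg.1 q
        have := hg.1 l
        refine ⟨some k, ⟨p, k, rfl, rfl, ?_⟩, some l, ⟨k, l, rfl, rfl, hkl, ho⟩,
          l, q, rfl, rfl, ?_⟩
        · rcases hh with hh | hh
          · right; omega
          · exact Or.inl hh.1.symm
        · rcases hh with ⟨_, hh | hh⟩ | hh
          · exact Or.inl hh
          · right; omega
          · right; omega
      · exact ⟨some p, ⟨p, p, rfl, rfl, Or.inl rfl⟩, some q, ⟨p, q, rfl, rfl, h, ho⟩,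
          q, q, rfl, rfl, Or.inl rfl⟩
  · intro p q
    simp only [rv_append, reaches_append, reaches_desc, reaches_letM, rv_desc, rv_letM]
    constructor
    · rintro ⟨_, ⟨⟨i, k, hi, rfl, h1⟩, _, ⟨k', l, hk, rfl, h2⟩, l', j, hl, hj, h3⟩ |
        ⟨⟨i, k, hi, rfl, h1⟩, _, ⟨h, _⟩ | ⟨⟨k', l, hk, rfl, h2⟩, l', j, hl, hj, h3⟩⟩⟩
      · simp only [Option.some.injEq] at hi hk hl hj
        subst hi hk hl hj
        rcases h3 with rfl | h3 <;> omega
      · exact h.elim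
      · simp only [Option.some.injEq] at hi hk hl hj
        subst hi hk hl hj
        rcases h1 with rfl | h1 <;> omega
    · intro h
      obtain ⟨k, l, hkl, ho, hh⟩ := key p q h
      have := hf.1 k
      have := hf.1 p
      have := hg.1 q
      have := hg.1 l
      refine ⟨some k, ?_⟩
      rcases hh with ⟨h1, h2⟩ | ⟨h1, h2⟩
      · left
        refine ⟨⟨p, k, rfl, rfl, by omega⟩, some l, ⟨k, l, rfl, rfl, hkl, ho⟩,
          l, q, rfl, rfl, ?_⟩
        rcases h2 with h2 | h2
        · exact Or.inl h2
        · right; omega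
      · right
        exact ⟨⟨p, k, rfl, rfl, Or.inl h1.symm⟩, some l,
          Or.inr ⟨⟨k, l, rfl, rfl, hkl, ho⟩, l, q, rfl, rfl, by omega⟩⟩
  · intro p q
    simp only [reaches_append, reaches_desc]
    rintro ⟨_, ⟨i, k, rfl, rfl, h1⟩, _, _, l', j, hl, rfl, h3⟩
    simp

end YanPaper
end

section
/- Let n > 1, 1 ≤ m < n, let f_0, f_1, …, f_l (with l > 0) be Q(m)-rankings for FB_n, and for each 0 ≤ i < l let w_i be an (f_i, f_{i+1})-segment for FB_n. Let w = w_0 w_1 ⋯ w_{l−1}. Then for all p, q ∈ S'_n: (i) if f_0(p) > f_l(q), or f_0(p) = f_l(q) and this value is odd, then p →_w q; (ii) if f_0(p) > f_l(q), then p →_{w,{s_f}} q. -/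
namespace YanPaper

theorem RunOn.append_aux {S A : Type*} (Δ : S → A → S → Prop) (r : S) (t : List S) (v : List A)
    (h2 : RunOn Δ (r :: t) v) : ∀ (ρ : List S) (u : List A), RunOn Δ ρ u →
    ρ.getLast? = some r → RunOn Δ (ρ ++ t) (u ++ v)
  | [], u, h, hr => by simp at hr
  | [x], [], _, hr => by
    simp at hr
    subst hr
    simpa using h2
  | [x], a :: u, h, _ => by simp [RunOn] at h
  | x :: y :: ρ, [], h, _ => by simp [RunOn] at h
  | x :: y :: ρ, a :: u, h, hr => by
    have h' : Δ x a y ∧ RunOn Δ (y :: ρ) u := h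
    have ih := RunOn.append_aux Δ r t v h2 (y :: ρ) u h'.2 (by simpa using hr)
    exact ⟨h'.1, ih⟩

theorem run_append {S A : Type*} {Δ : S → A → S → Prop} {p r q : S} {u v : List A}
    {ρ σ : List S} (h1 : RunOn Δ ρ u) (hp : ρ.head? = some p) (hr : ρ.getLast? = some r)
    (h2 : RunOn Δ σ v) (hr2 : σ.head? = some r) (hq : σ.getLast? = some q) :
    ∃ τ : List S, RunOn Δ τ (u ++ v) ∧ τ.head? = some p ∧ τ.getLast? = some q ∧
      (∀ s ∈ ρ, s ∈ τ) ∧ (∀ s ∈ σ, s ∈ τ) := by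
  cases σ with
  | nil => simp at hr2
  | cons x t =>
    simp at hr2
    subst hr2
    have hm := List.mem_of_getLast? hr
    refine ⟨ρ ++ t, RunOn.append_aux Δ x t v h2 ρ u h1 hr, ?_, ?_, ?_, ?_⟩
    · simp [List.head?_append, hp]
    · cases t with
      | nil => simpa [hr] using hq
      | cons y t =>
        rw [List.getLast?_cons_cons] at hq
        simp [List.getLast?_append, hq]
    · intro s hs
      simp [hs]
    · intro s hs
      rcases List.mem_cons.1 hs with rfl | hs
      · simp [hm]
      · simp [hs]

theorem Reaches.append {S A : Type*} {Δ : S → A → S → Prop} {p r q : S} {u v : List A}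
    (h1 : Reaches Δ p u r) (h2 : Reaches Δ r v q) : Reaches Δ p (u ++ v) q := by
  obtain ⟨ρ, a, b, c⟩ := h1
  obtain ⟨σ, d, e, g⟩ := h2
  obtain ⟨τ, x, y, z, _⟩ := run_append a b c d e g
  exact ⟨τ, x, y, z⟩

theorem ReachesVisit.append_left {S A : Type*} {Δ : S → A → S → Prop} {T : Set S} {p r q : S}
    {u v : List A} (h1 : ReachesVisit Δ T p u r) (h2 : Reaches Δ r v q) :
    ReachesVisit Δ T p (u ++ v) q := by
  obtain ⟨ρ, a, b, c, s, hs, hT⟩ := h1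
  obtain ⟨σ, d, e, g⟩ := h2
  obtain ⟨τ, x, y, z, k, _⟩ := run_append a b c d e g
  exact ⟨τ, x, y, z, s, k s hs, hT⟩

theorem ReachesVisit.append_right {S A : Type*} {Δ : S → A → S → Prop} {T : Set S} {p r q : S}
    {u v : List A} (h1 : Reaches Δ p u r) (h2 : ReachesVisit Δ T r v q) :
    ReachesVisit Δ T p (u ++ v) q := by
  obtain ⟨ρ, a, b, c⟩ := h1
  obtain ⟨σ, d, e, g, s, hs, hT⟩ := h2
  obtain ⟨τ, x, y, z, _, k⟩ := run_append a b c d e g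
  exact ⟨τ, x, y, z, s, k s hs, hT⟩

/-- concatenation of segments `w_0 ⋯ w_{l-1}` along `Q(m)`-rankings
`f_0, …, f_l` satisfies properties (i) and (ii). -/
theorem segment_concatenation (n m l : ℕ) (hn : 1 < n) (hm : 1 ≤ m) (hmn : m < n)
    (hl : 0 < l) (f : ℕ → Fin (n - 1) → ℕ) (hf : ∀ i ≤ l, QRanking n m (f i))
    (w : ℕ → List (FBAlpha n)) (hw : ∀ i < l, IsSeg n (f i) (f (i + 1)) (w i))
    (p q : Fin (n - 1)) :
    ((f l q < f 0 p ∨ (f 0 p = f l q ∧ Odd (f 0 p))) →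
      Reaches (FB n).Δ (some p) (((List.range l).map w).flatten) (some q)) ∧
    (f l q < f 0 p →
      ReachesVisit (FB n).Δ {none} (some p) (((List.range l).map w).flatten) (some q)) := by
  induction l, hl using Nat.le_induction generalizing q with
  | base =>
    obtain ⟨-, h1, h2, -⟩ := hw 0 (by omega)
    simpa using And.intro (h1 p q).2 (h2 p q).2
  | succ l hl ih =>
    have ih := ih (fun i hi => hf i (by omega)) (fun i hi => hw i (by omega))
    obtain ⟨-, h1, h2, -⟩ := hw l (by omega)
    have hfl := (hf l (by omega)).2
    have hp := (hf 0 (by omega)).1 p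
    have e : ((List.range (l + 1)).map w).flatten = ((List.range l).map w).flatten ++ w l := by
      simp [List.range_succ]
    rw [e]
    have key : f (l + 1) q < f 0 p → ReachesVisit (FB n).Δ {none} (some p)
        (((List.range l).map w).flatten ++ w l) (some q) := by
      intro hlt
      rcases Nat.even_or_odd (f 0 p) with hE | hO
      · have hO' : Odd (f 0 p - 1) := by
          rw [Nat.odd_iff]
          rw [Nat.even_iff] at hE
          omega
        obtain ⟨r, hr⟩ := hfl (f 0 p - 1) (by omega) hO'
        refine ReachesVisit.append_left ((ih r).2 (by omega)) ((h1 r q).2 ?_)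
        rcases Nat.lt_or_ge (f (l + 1) q) (f l r) with h | h
        · exact Or.inl h
        · exact Or.inr ⟨by omega, by rw [hr]; exact hO'⟩
      · obtain ⟨r, hr⟩ := hfl (f 0 p) hp hO
        exact ReachesVisit.append_right ((ih r).1 (Or.inr ⟨hr.symm, hO⟩))
          ((h2 r q).2 (by omega))
    refine ⟨?_, key⟩
    rintro (h | ⟨h, hO⟩)
    · obtain ⟨ρ, a, b, c, _⟩ := key h
      exact ⟨ρ, a, b, c⟩
    · obtain ⟨r, hr⟩ := hfl (f 0 p) hp hO
      exact Reaches.append ((ih r).1 (Or.inr ⟨hr.symm, hO⟩))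
        ((h1 r q).2 (Or.inr ⟨by omega, by rw [hr]; exact hO⟩))

end YanPaper
end

section
/- Let n > 1, 1 ≤ m < n, let (f_i)_{i≥0} be a sequence of Q(m)-rankings for FB_n, and for each i ≥ 0 let w_i be an (f_i, f_{i+1})-segment for FB_n. Then the ω-word α = w_0 w_1 w_2 ⋯ is not accepted by FB_n. -/
namespace YanPaper

theorem seg_run {S A : Type*} (Δ : S → A → S → Prop) (ρ : ℕ → S) (w : List A) (s : ℕ)
    (h : ∀ j (hj : j < w.length), Δ (ρ (s + j)) (w.get ⟨j, hj⟩) (ρ (s + j + 1))) :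
    ∃ l : List S, RunOn Δ (ρ s :: l) w ∧ (ρ s :: l).getLast? = some (ρ (s + w.length)) ∧
      ∀ j, j ≤ w.length → ρ (s + j) ∈ ρ s :: l := by
  induction w generalizing s with
  | nil =>
    refine ⟨[], by simp [RunOn], by simp, ?_⟩
    intro j hj
    have : j = 0 := by simpa using hj
    simp [this]
  | cons a w ih =>
    obtain ⟨l, h1, h2, h3⟩ := ih (s + 1) (by
      intro j hj
      have := h (j + 1) (by simpa using hj)
      simpa [Nat.add_assoc, Nat.add_comm, Nat.add_left_comm] using this)
    refine ⟨ρ (s + 1) :: l, ?_, ?_, ?_⟩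
    · exact ⟨by simpa using h 0 (by simp), h1⟩
    · rw [List.getLast?_cons_cons, h2]
      congr 2
      simp only [List.length_cons]
      omega
    · intro j hj
      rcases j with _ | j
      · simp
      · have := h3 j (by simpa using hj)
        rw [show s + (j + 1) = s + 1 + j by omega]
        exact List.mem_cons_of_mem _ this

/-- the ω-word `α = w_0 w_1 w_2 ⋯` obtained by concatenating segments along
an infinite sequence of `Q(m)`-rankings is not accepted by `FB n`. Here `kp i` marks the
position where `w_i` starts in `α`. -/
theorem omega_concatenation_not_accepted (n m : ℕ) (hn : 1 < n) (hm : 1 ≤ m) (hmn : m < n)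
    (f : ℕ → Fin (n - 1) → ℕ) (hf : ∀ i, QRanking n m (f i))
    (w : ℕ → List (FBAlpha n)) (hw : ∀ i, IsSeg n (f i) (f (i + 1)) (w i))
    (kp : ℕ → ℕ) (hk0 : kp 0 = 0) (hk : ∀ i, kp (i + 1) = kp i + (w i).length)
    (α : ℕ → FBAlpha n)
    (hα : ∀ i j (h : j < (w i).length), α (kp i + j) = (w i).get ⟨j, h⟩) :
    α ∉ (FB n).Lang := by
  rintro ⟨ρ, -, hΔ, x, hinf, hx⟩
  have hx' : x = none := hx
  subst hx'
  have hseg : ∀ i, ∃ l : List (FBState n), RunOn (FB n).Δ (ρ (kp i) :: l) (w i) ∧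
      (ρ (kp i) :: l).getLast? = some (ρ (kp (i + 1))) ∧
      ∀ j, j ≤ (w i).length → ρ (kp i + j) ∈ ρ (kp i) :: l := by
    intro i
    rw [hk i]
    apply seg_run
    intro j hj
    rw [← hα i j hj]
    exact hΔ _
  have hmain : ∀ i, ∃ p, ρ (kp i) = some p := by
    intro i
    obtain ⟨l, h1, h2, -⟩ := hseg i
    have := ((hw i).2.2.2 _ _ ⟨_, h1, rfl, h2⟩).1
    exact Option.ne_none_iff_exists'.mp this
  choose p hp using hmain
  have hle : ∀ i, f (i + 1) (p (i + 1)) ≤ f i (p i) := by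
    intro i
    obtain ⟨l, h1, h2, -⟩ := hseg i
    rw [hp i] at h1 h2
    rw [hp (i + 1)] at h2
    have := ((hw i).2.1 (p i) (p (i + 1))).1 ⟨_, h1, rfl, h2⟩
    omega
  have hlt : ∀ i j, j ≤ (w i).length → ρ (kp i + j) = none →
      f (i + 1) (p (i + 1)) < f i (p i) := by
    intro i j hj hn
    obtain ⟨l, h1, h2, h3⟩ := hseg i
    have h4 := h3 j hj
    rw [hp i] at h1 h2 h4
    rw [hp (i + 1)] at h2
    exact ((hw i).2.2.1 (p i) (p (i + 1))).1 ⟨_, h1, rfl, h2, _, h4, hn⟩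
  have hanti : Antitone (fun i => f i (p i)) := antitone_nat_of_succ_le hle
  obtain ⟨N, hN⟩ : ∃ N, ∀ i, f N (p N) ≤ f i (p i) := by
    obtain ⟨N, hN⟩ := Function.argmin_le (fun i => f i (p i)) |> fun h => (⟨_, fun i => h i⟩ :
      ∃ N, ∀ i, f N (p N) ≤ f i (p i))
    exact ⟨N, hN⟩
  have hmono : StrictMono kp := strictMono_nat_of_lt_succ (by
    intro i
    rw [hk i]
    have := List.length_pos_iff.mpr (hw i).1
    omega)
  obtain ⟨t, ht, hρ⟩ := hinf (kp N)
  have hex : ∃ i, N ≤ i ∧ kp i ≤ t ∧ t < kp (i + 1) := by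
    have hE : ∃ i, t < kp i := ⟨t + 1, lt_of_lt_of_le (Nat.lt_succ_self t) (hmono.id_le _)⟩
    have hs := Nat.find_spec hE
    have hNl : N < Nat.find hE := hmono.lt_iff_lt.mp (lt_of_le_of_lt ht hs)
    refine ⟨Nat.find hE - 1, by omega, ?_, ?_⟩
    · exact not_lt.mp (Nat.find_min hE (by omega))
    · rwa [Nat.sub_add_cancel (by omega)]
  obtain ⟨i, hi, h1, h2⟩ := hex
  have h3 := hlt i (t - kp i) (by rw [hk i] at h2; omega) (by
    rw [Nat.add_sub_cancel' h1]; exact hρ)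
  have h4 := hN (i + 1)
  have h5 : f i (p i) ≤ f N (p N) := hanti hi
  omega

end YanPaper
end

section
/- Let n > 1 and fix 1 ≤ m < n with L(n, m) = L(n); write L = L(n). Let f_0, …, f_{L−1} be an enumeration of all the (pairwise distinct) Q(m)-rankings for FB_n, extended periodically by f_{jL+i} = f_i for all j ≥ 0 and 0 ≤ i < L. For each i ≥ 0 let w_i be an (f_i, f_{i+1})-segment for FB_n, and let α_n = w_0 w_1 w_2 ⋯. Then for every transition structure 𝒜 = (Σ_n, Ŝ, Î, Δ̂) with finite state set Ŝ, |Ŝ| < L, initial states Î ⊆ Ŝ and transition relation Δ̂ ⊆ Ŝ × Σ_n × Ŝ, and for every run ρ of 𝒜 over α_n (i.e., ρ : ℕ → Ŝ with ρ(0) ∈ Î and (ρ(i), α_n(i), ρ(i+1)) ∈ Δ̂ for all i ≥ 0), there exist an ω-word α' ∈ L(FB_n) and a run ρ' of 𝒜 over α' such that Occ(ρ') = Occ(ρ) and Inf(ρ') = Inf(ρ), where Occ denotes the set of states occurring in a run and Inf the set of states occurring infinitely often in it. -/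
namespace YanPaper

theorem runOn_fun {S A : Type*} (Δ : S → A → S → Prop) (x : S) :
    ∀ (w : List A) (r : List S), RunOn Δ r w → r.length = w.length + 1 ∧
      ∀ k (h : k < w.length), Δ (r.getD k x) (w.get ⟨k, h⟩) (r.getD (k+1) x)
  | [], [], h => by simp [RunOn] at h
  | [], [p], h => by simp
  | [], p :: q :: r, h => by simp [RunOn] at h
  | a :: w, [], h => by simp [RunOn] at h
  | a :: w, [p], h => by simp [RunOn] at h
  | a :: w, p :: q :: r, h => by
    obtain ⟨h1, h2⟩ := h
    obtain ⟨h3, h4⟩ := runOn_fun Δ x w (q :: r) h2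
    refine ⟨by simpa using h3, ?_⟩
    intro k hk
    cases k with
    | zero => simpa using h1
    | succ k => simpa using h4 k (by simpa using hk)

/-- Path between positions `i` and `j`; visits the final state if `V`. -/
def PPath {n : ℕ} (α : ℕ → FBAlpha n) (V : Prop) (p : FBState n) (i : ℕ) (q : FBState n)
    (j : ℕ) : Prop :=
  ∃ σ : ℕ → FBState n, σ i = p ∧ σ j = q ∧ (∀ k, i ≤ k → k < j → (σ k, σ (k+1)) ∈ α k) ∧
    (V → ∃ k, i ≤ k ∧ k ≤ j ∧ σ k = none)

theorem PPath.weak {n : ℕ} {α : ℕ → FBAlpha n} {V V' : Prop} {p q : FBState n} {i j : ℕ}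
    (h : PPath α V p i q j) (hV : V' → V) : PPath α V' p i q j := by
  obtain ⟨σ, h1, h2, h3, h4⟩ := h
  exact ⟨σ, h1, h2, h3, fun v => h4 (hV v)⟩

theorem PPath.trans {n : ℕ} {α : ℕ → FBAlpha n} {V V' : Prop} {p q r : FBState n} {i j k : ℕ}
    (hij : i ≤ j) (hjk : j ≤ k)
    (h : PPath α V p i q j) (h' : PPath α V' q j r k) : PPath α (V ∨ V') p i r k := by
  obtain ⟨σ, h1, h2, h3, h4⟩ := h
  obtain ⟨σ', h1', h2', h3', h4'⟩ := h'
  refine ⟨fun l => if l ≤ j then σ l else σ' l, by simp [hij, h1], ?_, ?_, ?_⟩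
  · by_cases hh : k ≤ j
    · have : k = j := le_antisymm hh hjk
      subst this
      simp [h2, ← h2', h1']
    · simp [hh, h2']
  · intro l hl hlk
    rcases lt_trichotomy l j with hlt | heq | hgt
    · have : l + 1 ≤ j := hlt
      simpa [hlt.le, this] using h3 l hl hlt
    · subst heq
      have := h3' l le_rfl hlk
      rw [h1'] at this
      simpa [h2] using this
    · have a1 : ¬ l ≤ j := by omega
      have a2 : ¬ l + 1 ≤ j := by omega
      simpa [a1, a2] using h3' l hgt.le hlk
  · rintro (v | v)
    · obtain ⟨l, a, b, c⟩ := h4 v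
      exact ⟨l, a, b.trans hjk, by simp [b, c]⟩
    · obtain ⟨l, a, b, c⟩ := h4' v
      refine ⟨l, by omega, b, ?_⟩
      by_cases hh : l ≤ j
      · have : l = j := le_antisymm hh a
        subst this
        simp [h2, ← h1', c]
      · simp [hh, c]

theorem seg_path {n : ℕ} {α : ℕ → FBAlpha n} {w : List (FBAlpha n)} {K : ℕ}
    (hα : ∀ j (h : j < w.length), α (K + j) = w.get ⟨j, h⟩)
    {f g : Fin (n-1) → ℕ} (hw : IsSeg n f g w) (p q : Fin (n-1))
    (h : g q < f p ∨ (f p = g q ∧ Odd (f p))) :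
    PPath α (g q < f p) (some p) K (some q) (K + w.length) := by
  obtain ⟨-, h1, h2, -⟩ := hw
  have key : ∃ r, RunOn (FB n).Δ r w ∧ r.head? = some (some p) ∧ r.getLast? = some (some q) ∧
      (g q < f p → none ∈ r) := by
    by_cases hlt : g q < f p
    · obtain ⟨r, a, b, c, s, d, e⟩ := (h2 p q).2 hlt
      have e : s = none := e
      subst e
      exact ⟨r, a, b, c, fun _ => d⟩
    · obtain ⟨r, a, b, c⟩ := (h1 p q).2 h
      exact ⟨r, a, b, c, fun x => absurd x hlt⟩
  obtain ⟨r, a, b, c, d⟩ := key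
  obtain ⟨e1, e2⟩ := runOn_fun (FB n).Δ none w r a
  refine ⟨fun l => r.getD (l - K) none, ?_, ?_, ?_, ?_⟩
  · rw [List.head?_eq_getElem?] at b
    simp [List.getD, b]
  · rw [List.getLast?_eq_getElem?, e1] at c
    simp only [Nat.add_sub_cancel] at c
    simp [List.getD, c]
  · intro k hk hk'
    obtain ⟨j, rfl⟩ := Nat.exists_eq_add_of_le hk
    have hj : j < w.length := by omega
    have := e2 j hj
    rw [← hα j hj] at this
    have a1 : K + j - K = j := by omega
    have a2 : K + j + 1 - K = j + 1 := by omega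
    simp only [a1, a2]
    exact this
  · intro v
    obtain ⟨l, hl, hl'⟩ := List.getElem_of_mem (d v)
    refine ⟨K + l, by omega, by omega, ?_⟩
    simp [List.getD, hl, hl']

theorem long_path {n m : ℕ} {α : ℕ → FBAlpha n} {f : ℕ → Fin (n-1) → ℕ}
    (hf : ∀ i, QRanking n m (f i)) {kp : ℕ → ℕ} (hmono : StrictMono kp)
    (hstep : ∀ i p q, (f (i+1) q < f i p ∨ (f i p = f (i+1) q ∧ Odd (f i p))) →
      PPath α (f (i+1) q < f i p) (some p) (kp i) (some q) (kp (i+1)))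
    {o : ℕ} (ho : Odd o) (ho' : o < 2 * m) (q : Fin (n-1)) (d : ℕ) :
    ∀ a p, o ≤ f a p → f (a+d+1) q ≤ o →
      PPath α (f (a+d+1) q < f a p) (some p) (kp a) (some q) (kp (a+d+1)) := by
  have st : ∀ a p q, o ≤ f a p → f (a+1) q ≤ o →
      PPath α (f (a+1) q < f a p) (some p) (kp a) (some q) (kp (a+1)) := by
    intro a p q h1 h2
    apply hstep
    rcases lt_or_eq_of_le (h2.trans h1) with h | h
    · exact Or.inl h
    · have : f a p = o := by omega
      exact Or.inr ⟨h.symm, this ▸ ho⟩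
  induction d with
  | zero => intro a p h1 h2; exact st a p q h1 h2
  | succ d ih =>
    intro a p h1 h2
    obtain ⟨p', hp'⟩ := (hf (a+1)).2 o ho' ho
    have e : a + (d+1) + 1 = (a+1) + d + 1 := by omega
    rw [e] at h2 ⊢
    have A := st a p p' h1 hp'.le
    have B := ih (a+1) p' hp'.ge h2
    refine (A.trans (hmono.monotone (by omega)) (hmono.monotone (by omega)) B).weak ?_
    intro h
    omega

theorem exists_unif {T : Type} [Fintype T] (P : T → ℕ → Prop)
    (h : ∀ t, ∃ N, ∀ M ≥ N, P t M) : ∃ N, ∀ M ≥ N, ∀ t, P t M := by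
  choose g hg using h
  exact ⟨Finset.univ.sup g, fun M hM t => hg t M ((Finset.le_sup (Finset.mem_univ t)).trans hM)⟩

/-- Lasso time change. -/
def lasso (A c i : ℕ) : ℕ := if i < A then i else A + (i - A) % c

theorem lasso_step (A c i : ℕ) (hc : 0 < c) :
    (lasso A c (i+1) = lasso A c i + 1) ∨ (lasso A c i + 1 = A + c ∧ lasso A c (i+1) = A) := by
  unfold lasso
  rcases lt_trichotomy (i+1) A with h | h | h
  · left; rw [if_pos h, if_pos (by omega)]
  · left; rw [if_neg (by omega), if_pos (by omega), ← h]; simp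
  · rw [if_neg (by omega), if_neg (by omega)]
    have e : i + 1 - A = (i - A) + 1 := by omega
    rw [e]
    have h1 := Nat.mod_lt (i - A) hc
    rw [Nat.add_mod_eq_ite]
    rcases Nat.lt_or_ge 1 c with hc1 | hc1
    · rw [Nat.mod_eq_of_lt hc1]
      split_ifs <;> omega
    · have : c = 1 := by omega
      subst this
      simp [Nat.mod_one]

theorem lasso_lt (A c i : ℕ) (hc : 0 < c) : lasso A c i < A + c := by
  unfold lasso
  have h1 := Nat.mod_lt (i - A) hc
  split_ifs <;> omega

theorem lasso_ge (A c i : ℕ) (hi : A ≤ i) : A ≤ lasso A c i := by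
  unfold lasso
  split_ifs <;> omega

theorem lasso_loop (A c k N : ℕ) (h : A ≤ k) (h' : k < A + c) : lasso A c (k + N * c) = k := by
  unfold lasso
  rw [if_neg (by have := Nat.zero_le (N*c); omega)]
  have e : k + N * c - A = (k - A) + N * c := by omega
  rw [e, Nat.add_mul_mod_self_right, Nat.mod_eq_of_lt (by omega)]
  omega

theorem lasso_lang {n : ℕ} {α : ℕ → FBAlpha n} {p0 p : Fin (n-1)} {A c : ℕ} (hc : 0 < c)
    (h1 : PPath α False (some p0) 0 (some p) A)
    (h2 : PPath α True (some p) A (some p) (A + c)) :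
    (fun i => α (lasso A c i)) ∈ (FB n).Lang := by
  obtain ⟨σ, a1, a2, a3, -⟩ := h1
  obtain ⟨τ, b1, b2, b3, b4⟩ := h2
  obtain ⟨k, k1, k2, k3⟩ := b4 trivial
  have hk : k < A + c := by
    rcases lt_or_eq_of_le k2 with h | h
    · exact h
    · rw [h, b2] at k3; simp at k3
  refine ⟨fun i => if i < A then σ i else τ (lasso A c i), ?_, ?_, none, ?_, rfl⟩
  · show _ ≠ none
    by_cases hA : 0 < A
    · simp [hA, a1]
    · have : A = 0 := by omega
      subst this
      simp [lasso, b1]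
  · intro i
    show (_, _) ∈ α (lasso A c i)
    by_cases hi : i < A
    · have e : lasso A c i = i := by simp [lasso, hi]
      have := a3 i (by omega) hi
      rw [e]
      by_cases hi' : i + 1 < A
      · simpa [hi, hi'] using this
      · have e' : i + 1 = A := by omega
        have : (σ i, some p) ∈ α i := by rw [← a2, ← e']; exact this
        simpa [hi, hi', lasso, e', b1] using this
    · have hi' : ¬ i + 1 < A := by omega
      simp only [hi, hi', if_false]
      have l1 := lasso_ge A c i (by omega)
      have l2 := lasso_lt A c i hc
      have := b3 _ l1 l2
      rcases lasso_step A c i hc with h | ⟨h, h'⟩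
      · rw [h]; exact this
      · rw [h', b1, ← b2, ← h]; exact this
  · intro N
    have : N ≤ N * c := Nat.le_mul_of_pos_right N hc
    refine ⟨k + N * c, by omega, ?_⟩
    have h' : ¬ (k + N * c < A) := by omega
    simp only [h', if_false]
    rw [lasso_loop A c k N k1 hk, k3]

/-- if an automaton transition structure has fewer than `L(n)` states, then any
run over the hard word `α_n` can be turned into a run over a word accepted by `FB n`
with the same `Occ` and `Inf` sets. -/
theorem confusion_lemma (n m : ℕ) (hn : 1 < n) (hm : 1 ≤ m) (hmn : m < n)
    (hL : Lnm n m = Lmax n)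
    (f : ℕ → Fin (n - 1) → ℕ) (hf : ∀ i, QRanking n m (f i))
    (hinj : ∀ i < Lnm n m, ∀ j < Lnm n m, f i = f j → i = j)
    (hsurj : ∀ g : Fin (n - 1) → ℕ, QRanking n m g → ∃ i < Lnm n m, f i = g)
    (hper : ∀ j i, i < Lnm n m → f (j * Lnm n m + i) = f i)
    (w : ℕ → List (FBAlpha n)) (hw : ∀ i, IsSeg n (f i) (f (i + 1)) (w i))
    (kp : ℕ → ℕ) (hk0 : kp 0 = 0) (hk : ∀ i, kp (i + 1) = kp i + (w i).length)
    (α : ℕ → FBAlpha n)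
    (hα : ∀ i j (h : j < (w i).length), α (kp i + j) = (w i).get ⟨j, h⟩)
    (T : Type) [Fintype T] (hT : Fintype.card T < Lnm n m)
    (I : Set T) (D : T → FBAlpha n → T → Prop)
    (ρ : ℕ → T) (hρ0 : ρ 0 ∈ I) (hρ : ∀ i, D (ρ i) (α i) (ρ (i + 1))) :
    ∃ α' ∈ (FB n).Lang, ∃ ρ' : ℕ → T,
      ρ' 0 ∈ I ∧ (∀ i, D (ρ' i) (α' i) (ρ' (i + 1))) ∧
      Set.range ρ' = Set.range ρ ∧ InfOcc ρ' = InfOcc ρ := by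
  have hkp : StrictMono kp := strictMono_nat_of_lt_succ (fun i => by
    have : 0 < (w i).length := List.length_pos_iff.2 (hw i).1
    rw [hk]; omega)
  have hstep : ∀ i p q, (f (i+1) q < f i p ∨ (f i p = f (i+1) q ∧ Odd (f i p))) →
      PPath α (f (i+1) q < f i p) (some p) (kp i) (some q) (kp (i+1)) := by
    intro i p q h
    rw [hk]
    exact seg_path (hα i) (hw i) p q h
  -- states recurring at each residue
  have hrec : ∀ i : Fin (Lnm n m), ∃ t : T, ∀ N, ∃ a ≥ N, f a = f i ∧ ρ (kp a) = t := by
    intro i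
    by_contra! hcon
    obtain ⟨N, hN⟩ := exists_unif (fun t M => f M = f i → ρ (kp M) ≠ t) (fun t => by
      obtain ⟨N, hN⟩ := hcon t
      exact ⟨N, hN⟩)
    have hLpos : 0 < Lnm n m := i.pos
    have : N ≤ N * Lnm n m := Nat.le_mul_of_pos_right N hLpos
    exact hN (N * Lnm n m + i) (by omega) _ (hper N i i.2) rfl
  choose st hst using hrec
  obtain ⟨i, j, hij, heq⟩ := Fintype.exists_ne_map_eq_of_card_lt st (by simpa using hT)
  obtain ⟨t, u, v, p, hlt, hu, hv⟩ : ∃ (t : T) (u v : Fin (n-1) → ℕ) (p : Fin (n-1)), v p < u p ∧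
      (∀ N, ∃ a ≥ N, f a = u ∧ ρ (kp a) = t) ∧ (∀ N, ∃ a ≥ N, f a = v ∧ ρ (kp a) = t) := by
    have hne : f i ≠ f j := fun h => hij (Fin.ext (hinj i i.2 j j.2 h))
    obtain ⟨p, hp⟩ := Function.ne_iff.1 hne
    rcases lt_or_gt_of_ne hp with h | h
    · exact ⟨st i, f j, f i, p, h, heq ▸ hst j, hst i⟩
    · exact ⟨st i, f i, f j, p, h, hst i, heq ▸ hst j⟩
  obtain ⟨M1, hM1⟩ := exists_unif (fun s M => s ∈ Set.range ρ → ∃ k < M, ρ k = s) (fun s => by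
    by_cases hs : s ∈ Set.range ρ
    · obtain ⟨k, hk⟩ := hs
      exact ⟨k + 1, fun M hM _ => ⟨k, by omega, hk⟩⟩
    · exact ⟨0, fun M _ h => absurd h hs⟩)
  obtain ⟨M2, hM2⟩ := exists_unif (fun s M => ρ M = s → s ∈ InfOcc ρ) (fun s => by
    by_cases hs : s ∈ InfOcc ρ
    · exact ⟨0, fun M _ _ => hs⟩
    · have hs' := hs
      simp only [InfOcc, Set.mem_setOf_eq, not_forall, not_exists, not_and] at hs'
      obtain ⟨N, hN⟩ := hs'
      exact ⟨N, fun M hM h => absurd h (hN M hM)⟩)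
  obtain ⟨a, ha, fa, ra⟩ := hu (M1 + M2 + 1)
  have hA : a ≤ kp a := hkp.id_le a
  obtain ⟨M3, hM3⟩ := exists_unif (fun s M => s ∈ InfOcc ρ → ∃ k, kp a ≤ k ∧ k < M ∧ ρ k = s)
    (fun s => by
      by_cases hs : s ∈ InfOcc ρ
      · obtain ⟨k, hk1, hk2⟩ := hs (kp a)
        exact ⟨k + 1, fun M hM _ => ⟨k, hk1, by omega, hk2⟩⟩
      · exact ⟨0, fun M _ h => absurd h hs⟩)
  obtain ⟨b, hb, fb, rb⟩ := hv (M3 + a + 1)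
  have hB : b ≤ kp b := hkp.id_le b
  have hAB : kp a < kp b := hkp (by omega)
  obtain ⟨c, hc⟩ := Nat.exists_eq_add_of_lt hAB
  have hc : kp b = kp a + (c + 1) := by omega
  -- the prefix
  have hpre : ∃ p0, PPath α False (some p0) 0 (some p) (kp a) := by
    have ho : Odd (2 * m - 1) := ⟨m - 1, by omega⟩
    obtain ⟨p0, hp0⟩ := (hf 0).2 (2*m-1) (by omega) ho
    obtain ⟨d, hd⟩ : ∃ d, a = 0 + d + 1 := ⟨a - 1, by omega⟩
    have h1 := (hf a).1 p
    have := long_path hf hkp hstep ho (by omega) p d 0 p0 hp0.ge (by rw [← hd]; omega)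
    rw [← hd, hk0] at this
    exact ⟨p0, this.weak False.elim⟩
  obtain ⟨p0, hpre⟩ := hpre
  have hloop : PPath α True (some p) (kp a) (some p) (kp a + (c+1)) := by
    obtain ⟨o, ho, o1, o2⟩ : ∃ o, Odd o ∧ v p ≤ o ∧ o ≤ u p := by
      rcases Nat.even_or_odd (v p) with h | h
      · exact ⟨v p + 1, h.add_one, by omega, hlt⟩
      · exact ⟨v p, h, le_rfl, hlt.le⟩
    obtain ⟨d, hd⟩ : ∃ d, b = a + d + 1 := ⟨b - a - 1, by omega⟩
    have h1 := (hf a).1 p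
    rw [fa] at h1
    have := long_path hf hkp hstep ho (by omega) p d a p (by rw [fa]; exact o2)
      (by rw [← hd, fb]; exact o1)
    rw [← hd, hc] at this
    exact this.weak (fun _ => by rw [fa, fb]; exact hlt)
  have hc0 : 0 < c + 1 := by omega
  refine ⟨_, lasso_lang hc0 hpre hloop, fun i => ρ (lasso (kp a) (c+1) i), ?_, ?_, ?_, ?_⟩
  · have : lasso (kp a) (c+1) 0 = 0 := by
      unfold lasso; rw [if_pos (by omega)]
    simpa only [this] using hρ0
  · intro i
    have := hρ (lasso (kp a) (c+1) i)
    rcases lasso_step (kp a) (c+1) i hc0 with h | ⟨h, h'⟩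
    · show D _ _ (ρ (lasso (kp a) (c+1) (i+1)))
      rw [h]; exact this
    · show D _ _ (ρ (lasso (kp a) (c+1) (i+1)))
      rw [h', ra, ← rb, hc, ← h]; exact this
  · apply Set.Subset.antisymm
    · rintro _ ⟨i, rfl⟩
      exact ⟨_, rfl⟩
    · intro s hs
      obtain ⟨k, hk1, hk2⟩ := hM1 (kp a) (by omega) s hs
      refine ⟨k, ?_⟩
      have : lasso (kp a) (c+1) k = k := by
        unfold lasso; rw [if_pos hk1]
      simpa only [this] using hk2
  · apply Set.Subset.antisymm
    · intro s hs
      obtain ⟨k, hk1, hk2⟩ := hs (kp a)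
      have := lasso_ge (kp a) (c+1) k hk1
      exact hM2 _ (by omega) s hk2
    · intro s hs N
      obtain ⟨k, hk1, hk2, hk3⟩ := hM3 (kp b) (by omega) s hs
      have : N ≤ N * (c+1) := Nat.le_mul_of_pos_right N hc0
      refine ⟨k + N * (c+1), by omega, ?_⟩
      show ρ _ = s
      rw [lasso_loop _ _ _ _ hk1 (by omega), hk3]

end YanPaper
end
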